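/- arXiv:math/9201228 — 2 statements merged into one kernel-verified Lean document; each statement's English description precedes it below -/
import Mathlib

section
/- There is an absolute constant K such that every bounded linear operator u from the disc algebra A into the Hilbert space ℓ₂ extends to a bounded linear operator û : C(𝕋, ℂ) → ℓ₂ with û restricted to A equal to u and ‖û‖ ≤ K‖u‖. -/
open MeasureTheory Real

noncomputable section

instance : Fact (0 < 2 * Real.pi) := ⟨by positivity⟩

/-- The circle group `𝕋`, realized as `ℝ / 2πℤ`, with its normalized Haar measure. -/
abbrev 𝕋 : Type := AddCircle (2 * Real.pi)

lemma fourier_smul_integrable (f : C(𝕋, ℂ)) (n : ℤ) :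
    Integrable (fun t : 𝕋 => fourier (-n) t • f t) AddCircle.haarAddCircle := by
  refine integrableOn_univ.mp ?_
  exact ContinuousOn.integrableOn_compact isCompact_univ
    (Continuous.continuousOn ((fourier (-n)).continuous.smul (map_continuous f)))

/-- The disc algebra: the subspace of `C(𝕋, ℂ)` consisting of continuous functions whose
Fourier coefficients vanish on the negative integers. -/
def discAlgebra : Submodule ℂ C(𝕋, ℂ) where
  carrier := {f | ∀ n : ℤ, n < 0 → fourierCoeff (⇑f) n = 0}
  zero_mem' := by
    intro n _
    simp [fourierCoeff]
  add_mem' := by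
    intro f g hf hg n hn
    have : fourierCoeff (⇑(f + g)) n = fourierCoeff (⇑f) n + fourierCoeff (⇑g) n := by
      simp only [fourierCoeff]
      rw [← integral_add (fourier_smul_integrable f n) (fourier_smul_integrable g n)]
      congr 1
      ext t
      simp only [ContinuousMap.coe_add, Pi.add_apply, smul_eq_mul]
      ring
    rw [this, hf n hn, hg n hn, add_zero]
  smul_mem' := by
    intro c f hf n hn
    have : fourierCoeff (⇑(c • f)) n = c • fourierCoeff (⇑f) n := by
      simp only [fourierCoeff]
      rw [← integral_smul]
      congr 1
      ext t
      simp only [ContinuousMap.coe_smul, Pi.smul_apply, smul_eq_mul]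
      ring
    rw [this, hf n hn, smul_zero]

open Filter Topology ContinuousMap
open scoped ComplexConjugate

/-- The normalized Haar measure of the circle. -/
local notation "𝔪" => (AddCircle.haarAddCircle : Measure 𝕋)

lemma ContinuousMap.integrable_haarAddCircle {E : Type*} [NormedAddCommGroup E] (f : C(𝕋, E)) :
    Integrable f 𝔪 :=
  (map_continuous f).integrable_of_hasCompactSupport (HasCompactSupport.of_compactSpace _)

lemma Continuous.integrable_haarAddCircle {E : Type*} [NormedAddCommGroup E] {f : 𝕋 → E}
    (hf : Continuous f) : Integrable f 𝔪 :=
  ContinuousMap.integrable_haarAddCircle ⟨f, hf⟩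

section Density

variable {V : Type*} [NormedAddCommGroup V] [NormedSpace ℂ V]

/-- The operator `f ↦ ∫ f Φ` on `C(𝕋, ℂ)` with continuous vector-valued density `Φ`. -/
def densityOp (Φ : C(𝕋, V)) : C(𝕋, ℂ) →L[ℂ] V :=
  LinearMap.mkContinuous
    { toFun := fun f => ∫ t, f t • Φ t ∂𝔪
      map_add' := fun f g => by
        simp only [ContinuousMap.add_apply, add_smul]
        exact integral_add (by fun_prop : Continuous fun t => f t • Φ t).integrable_haarAddCircle
          (by fun_prop : Continuous fun t => g t • Φ t).integrable_haarAddCircle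
      map_smul' := fun c f => by
        simp only [ContinuousMap.smul_apply, smul_eq_mul, mul_smul, RingHom.id_apply]
        exact integral_smul c _ } ‖Φ‖
    (fun f => by
      refine (norm_integral_le_of_norm_le_const (C := ‖Φ‖ * ‖f‖) (ae_of_all _ fun t => ?_)).trans ?_
      · rw [norm_smul, mul_comm]
        exact mul_le_mul (Φ.norm_coe_le_norm t) (f.norm_coe_le_norm t) (norm_nonneg _)
          (norm_nonneg _)
      · simp)

lemma densityOp_apply (Φ : C(𝕋, V)) (f : C(𝕋, ℂ)) : densityOp Φ f = ∫ t, f t • Φ t ∂𝔪 := rfl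

end Density

/-- The mean value functional on `C(𝕋, ℂ)`. -/
def meanL : C(𝕋, ℂ) →L[ℂ] ℂ := densityOp 1

lemma meanL_apply (f : C(𝕋, ℂ)) : meanL f = ∫ t, f t ∂𝔪 := by
  simp [meanL, densityOp_apply]

/-- The `n`-th Fourier coefficient as a continuous functional on `C(𝕋, ℂ)`. -/
def coeffL (n : ℤ) : C(𝕋, ℂ) →L[ℂ] ℂ := densityOp (fourier (-n))

lemma coeffL_apply (n : ℤ) (f : C(𝕋, ℂ)) : coeffL n f = fourierCoeff f n := by
  simp [coeffL, densityOp_apply, fourierCoeff, mul_comm]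

lemma meanL_eq_coeffL : meanL = coeffL 0 := by
  ext f
  simp [meanL_apply, coeffL, densityOp_apply]

lemma coeffL_eq_meanL (n : ℤ) (f : C(𝕋, ℂ)) : coeffL n f = meanL (f * fourier (-n)) := by
  simp [coeffL, densityOp_apply, meanL_apply]

lemma coeffL_fourier (n m : ℤ) : coeffL n (fourier m) = if n = m then 1 else 0 := by
  rw [coeffL_apply, fourierCoeff_fourier, Pi.single_apply]

lemma fourier_mul_fourier (m n : ℤ) :
    (fourier m * fourier n : C(𝕋, ℂ)) = fourier (m + n) := by
  ext t; simp

lemma coeffL_fourier_mul (n m : ℤ) (f : C(𝕋, ℂ)) :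
    coeffL n (fourier m * f) = coeffL (n - m) f := by
  rw [coeffL_eq_meanL, coeffL_eq_meanL, mul_comm (fourier m), mul_assoc, fourier_mul_fourier]
  congr 3
  ring_nf

lemma mem_discAlgebra_iff {f : C(𝕋, ℂ)} : f ∈ discAlgebra ↔ ∀ n : ℤ, n < 0 → coeffL n f = 0 := by
  simp only [coeffL_apply]; rfl

lemma isClosed_discAlgebra : IsClosed (discAlgebra : Set C(𝕋, ℂ)) := by
  have : (discAlgebra : Set C(𝕋, ℂ)) = ⋂ n : ℤ, ⋂ _ : n < 0, {f | coeffL n f = 0} := by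
    ext f; simp [mem_discAlgebra_iff]
  rw [this]
  exact isClosed_iInter fun n => isClosed_iInter fun _ =>
    isClosed_eq (coeffL n).continuous continuous_const

lemma fourier_mem_discAlgebra (n : ℕ) : (fourier (n : ℤ) : C(𝕋, ℂ)) ∈ discAlgebra := by
  rw [mem_discAlgebra_iff]
  intro k hk
  rw [coeffL_fourier, if_neg (by omega)]

/-- The `n`-th Fejér mean. -/
def fejer (n : ℕ) : C(𝕋, ℂ) →L[ℂ] C(𝕋, ℂ) :=
  (n : ℂ)⁻¹ • ∑ k ∈ Finset.range n, ∑ l ∈ Finset.range n,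
    (coeffL ((k : ℤ) - l)).smulRight (fourier ((k : ℤ) - l))

lemma fejer_apply (n : ℕ) (f : C(𝕋, ℂ)) : fejer n f =
    (n : ℂ)⁻¹ • ∑ k ∈ Finset.range n, ∑ l ∈ Finset.range n,
      coeffL ((k : ℤ) - l) f • fourier ((k : ℤ) - l) := by
  simp [fejer]

/-- The value of the Fejér kernel at `x - t`. -/
def fejerKernel (n : ℕ) (x t : 𝕋) : ℝ :=
  (n : ℝ)⁻¹ * Complex.normSq (∑ k ∈ Finset.range n, fourier (k : ℤ) x * fourier (-(k : ℤ)) t)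

lemma fejer_eq_integral (n : ℕ) (f : C(𝕋, ℂ)) (x : 𝕋) :
    fejer n f x = ∫ t, f t * (fejerKernel n x t : ℂ) ∂𝔪 := by
  have h : ∀ t, f t * (fejerKernel n x t : ℂ) = (n : ℂ)⁻¹ * ∑ k ∈ Finset.range n,
      ∑ l ∈ Finset.range n, fourier ((k : ℤ) - l) x * (f t * fourier (-((k : ℤ) - l)) t) := by
    intro t
    simp only [fejerKernel, Complex.ofReal_mul, Complex.ofReal_inv, Complex.ofReal_natCast]
    rw [← Complex.mul_conj, map_sum, Finset.sum_mul_sum, mul_left_comm, Finset.mul_sum]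
    congr 1
    refine Finset.sum_congr rfl fun k _ => ?_
    rw [Finset.mul_sum]
    refine Finset.sum_congr rfl fun l _ => ?_
    rw [map_mul, ← fourier_neg, ← fourier_neg, neg_neg, sub_eq_add_neg (k : ℤ), fourier_add,
      neg_add, neg_neg, fourier_add]
    ring
  simp only [h]
  rw [integral_const_mul, integral_finsetSum]
  · simp only [fejer_apply, ContinuousMap.smul_apply, ContinuousMap.sum_apply, smul_eq_mul]
    congr 1
    refine Finset.sum_congr rfl fun k _ => ?_
    rw [integral_finsetSum]
    · refine Finset.sum_congr rfl fun l _ => ?_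
      rw [integral_const_mul, coeffL, densityOp_apply, mul_comm]
      simp
    · exact fun l _ => Continuous.integrable_haarAddCircle (by fun_prop)
  · exact fun l _ => Continuous.integrable_haarAddCircle (by fun_prop)

lemma fejer_fourier (n : ℕ) (m : ℤ) : fejer n (fourier m) =
    ((n : ℂ)⁻¹ * ((Finset.range n).filter fun l : ℕ => 0 ≤ l + m ∧ l + m < n).card) •
      fourier m := by
  rw [fejer_apply, mul_smul, Finset.sum_comm]
  congr 1
  rw [Finset.card_filter, Nat.cast_sum, Finset.sum_smul]
  refine Finset.sum_congr rfl fun l _ => ?_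
  have : ∀ k : ℕ, (coeffL ((k : ℤ) - l) (fourier m) • fourier ((k : ℤ) - l) : C(𝕋, ℂ)) =
      if (k : ℤ) = l + m then fourier m else 0 := by
    intro k
    rw [coeffL_fourier]
    by_cases h : (k : ℤ) = l + m
    · rw [if_pos (by omega), if_pos h, one_smul]; congr 1; omega
    · rw [if_neg (by omega), if_neg h, zero_smul]
  simp only [this]
  by_cases h : 0 ≤ (l : ℤ) + m ∧ (l : ℤ) + m < n
  · rw [if_pos h, Finset.sum_eq_single ((l : ℤ) + m).toNat]
    · rw [if_pos (by omega)]; simp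
    · intro k _ hk; rw [if_neg (by omega)]
    · intro hk; simp only [Finset.mem_range] at hk; omega
  · rw [if_neg h, Finset.sum_eq_zero]
    · simp
    · intro k hk; simp only [Finset.mem_range] at hk; rw [if_neg (by omega)]

lemma fejer_one {n : ℕ} (hn : n ≠ 0) : fejer n 1 = 1 := by
  have h1 : (1 : C(𝕋, ℂ)) = fourier 0 := by ext t; simp
  rw [h1, fejer_fourier, Finset.filter_true_of_mem, Finset.card_range, inv_mul_cancel₀, one_smul]
  · exact_mod_cast hn
  · intro l hl; simp only [Finset.mem_range] at hl; omega

lemma norm_fejer_apply_le (n : ℕ) (f : C(𝕋, ℂ)) : ‖fejer n f‖ ≤ ‖f‖ := by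
  rcases eq_or_ne n 0 with rfl | hn
  · simp [fejer_apply]
  rw [ContinuousMap.norm_le _ (norm_nonneg _)]
  intro x
  have hK : ∀ t, 0 ≤ fejerKernel n x t := fun t =>
    mul_nonneg (by positivity) (Complex.normSq_nonneg _)
  have hc : Continuous (fejerKernel n x) := by
    unfold fejerKernel
    refine continuous_const.mul (Complex.continuous_normSq.comp ?_)
    fun_prop
  have hone : ∫ t, fejerKernel n x t ∂𝔪 = 1 := by
    have h := fejer_eq_integral n 1 x
    rw [fejer_one hn] at h
    simp only [ContinuousMap.one_apply, one_mul] at h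
    rw [integral_complex_ofReal] at h
    exact_mod_cast h.symm
  rw [fejer_eq_integral]
  calc ‖∫ t, f t * (fejerKernel n x t : ℂ) ∂𝔪‖ ≤ ∫ t, ‖f‖ * fejerKernel n x t ∂𝔪 := by
        refine norm_integral_le_of_norm_le (hc.integrable_haarAddCircle.const_mul _)
          (ae_of_all _ fun t => ?_)
        rw [norm_mul, Complex.norm_real, Real.norm_of_nonneg (hK t)]
        exact mul_le_mul_of_nonneg_right (f.norm_coe_le_norm t) (hK t)
    _ = ‖f‖ := by rw [integral_const_mul, hone, mul_one]

lemma tendsto_fejer_fourier (m : ℤ) :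
    Tendsto (fun n => fejer n (fourier m)) atTop (𝓝 (fourier m)) := by
  simp only [fejer_fourier]
  suffices h : Tendsto (fun n : ℕ => (n : ℝ)⁻¹ *
      ((Finset.range n).filter fun l : ℕ => 0 ≤ l + m ∧ l + m < n).card) atTop (𝓝 1) by
    have h2 := ((Complex.continuous_ofReal.tendsto 1).comp h).smul_const (fourier m : C(𝕋, ℂ))
    simpa [Function.comp_def] using h2
  have hlow : Tendsto (fun n : ℕ => 1 - (m.natAbs : ℝ) / n) atTop (𝓝 1) := by
    simpa using tendsto_const_nhds.sub (tendsto_const_div_atTop_nhds_zero_nat (m.natAbs : ℝ))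
  refine tendsto_of_tendsto_of_tendsto_of_le_of_le' hlow tendsto_const_nhds ?_ ?_
  · filter_upwards [eventually_gt_atTop 0] with n hn
    have hn' : (0 : ℝ) < n := by exact_mod_cast hn
    have hcard : n - m.natAbs ≤
        ((Finset.range n).filter fun l : ℕ => 0 ≤ l + m ∧ l + m < n).card := by
      have : (Finset.Ico (-m).toNat (n - m.toNat)).card = n - m.toNat - (-m).toNat := by simp
      have h2 : n - m.natAbs = (Finset.Ico (-m).toNat (n - m.toNat)).card := by omega
      rw [h2]
      refine Finset.card_le_card fun l hl => ?_
      simp only [Finset.mem_Ico, Finset.mem_filter, Finset.mem_range] at hl ⊢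
      omega
    have : (n : ℝ) - m.natAbs ≤
        ((Finset.range n).filter fun l : ℕ => 0 ≤ l + m ∧ l + m < n).card := by
      have := (Nat.sub_le_iff_le_add.1 hcard)
      rw [sub_le_iff_le_add]
      exact_mod_cast this
    calc 1 - (m.natAbs : ℝ) / n = (n : ℝ)⁻¹ * (n - m.natAbs) := by field_simp
      _ ≤ _ := by gcongr
  · filter_upwards [eventually_gt_atTop 0] with n hn
    have hn' : (0 : ℝ) < n := by exact_mod_cast hn
    rw [inv_mul_le_iff₀ hn', mul_one]
    exact_mod_cast (Finset.card_filter_le _ _).trans (by simp)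

lemma tendsto_fejer (f : C(𝕋, ℂ)) : Tendsto (fun n => fejer n f) atTop (𝓝 f) := by
  have hcl : f ∈ closure (Submodule.span ℂ (Set.range (fourier (T := 2 * Real.pi))) :
      Set C(𝕋, ℂ)) := by
    rw [← Submodule.topologicalClosure_coe, span_fourier_closure_eq_top]; trivial
  have hspan : ∀ g ∈ Submodule.span ℂ (Set.range (fourier (T := 2 * Real.pi))),
      Tendsto (fun n => fejer n g) atTop (𝓝 g) := by
    intro g hg
    induction hg using Submodule.span_induction with
    | mem x hx => obtain ⟨m, rfl⟩ := hx; exact tendsto_fejer_fourier m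
    | zero => simp
    | add x y _ _ hx hy => simpa using hx.add hy
    | smul c x _ hx => simpa using hx.const_smul c
  rw [Metric.tendsto_atTop]
  intro ε hε
  obtain ⟨g, hg, hfg⟩ := Metric.mem_closure_iff.1 hcl (ε / 3) (by positivity)
  obtain ⟨N, hN⟩ := Metric.tendsto_atTop.1 (hspan g hg) (ε / 3) (by positivity)
  refine ⟨N, fun n hn => ?_⟩
  have h1 : dist (fejer n f) (fejer n g) ≤ dist f g := by
    rw [dist_eq_norm, dist_eq_norm, ← map_sub]
    exact norm_fejer_apply_le n _
  have h2 := hN n hn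
  have h3 := dist_triangle4 (fejer n f) (fejer n g) g f
  rw [dist_comm g f] at h3
  linarith

/-- The span of the characters with non-negative frequency. -/
def analyticPolynomials : Submodule ℂ C(𝕋, ℂ) :=
  Submodule.span ℂ (Set.range fun n : ℕ => fourier (n : ℤ))

lemma fejer_mem_analyticPolynomials (n : ℕ) {f : C(𝕋, ℂ)} (hf : f ∈ discAlgebra) :
    fejer n f ∈ analyticPolynomials := by
  rw [fejer_apply]
  refine Submodule.smul_mem _ _ (Submodule.sum_mem _ fun k _ => Submodule.sum_mem _ fun l _ => ?_)
  rcases lt_or_ge ((k : ℤ) - l) 0 with h | h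
  · rw [mem_discAlgebra_iff.1 hf _ h, zero_smul]; exact Submodule.zero_mem _
  · refine Submodule.smul_mem _ _ (Submodule.subset_span ⟨((k : ℤ) - l).toNat, ?_⟩)
    simp only [Int.toNat_of_nonneg h]

lemma analyticPolynomials_le_discAlgebra : analyticPolynomials ≤ discAlgebra :=
  Submodule.span_le.2 (by rintro _ ⟨n, rfl⟩; exact fourier_mem_discAlgebra n)

/-- A closed subspace containing the characters of non-negative frequency contains the disc
algebra. -/
lemma discAlgebra_le_of_isClosed {S : Submodule ℂ C(𝕋, ℂ)} (hS : IsClosed (S : Set C(𝕋, ℂ)))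
    (h : ∀ n : ℕ, fourier (n : ℤ) ∈ S) : discAlgebra ≤ S := by
  intro f hf
  have hle : analyticPolynomials ≤ S := Submodule.span_le.2 (by rintro _ ⟨n, rfl⟩; exact h n)
  exact hS.mem_of_tendsto (tendsto_fejer f)
    (Eventually.of_forall fun n => hle (fejer_mem_analyticPolynomials n hf))

lemma discAlgebra_mul_aux {f g : C(𝕋, ℂ)} (hf : f ∈ discAlgebra) (hg : g ∈ discAlgebra) :
    f * g ∈ discAlgebra ∧ meanL (f * g) = meanL f * meanL g := by
  let S : Submodule ℂ C(𝕋, ℂ) :=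
    { carrier := {f | f * g ∈ discAlgebra ∧ meanL (f * g) = meanL f * meanL g}
      zero_mem' := by simp
      add_mem' := fun {a b} ha hb => by
        refine ⟨?_, ?_⟩
        · rw [add_mul]; exact add_mem ha.1 hb.1
        · rw [add_mul, map_add, ha.2, hb.2, map_add, add_mul]
      smul_mem' := fun c a ha => by
        refine ⟨?_, ?_⟩
        · rw [smul_mul_assoc]; exact Submodule.smul_mem _ c ha.1
        · rw [smul_mul_assoc, map_smul, ha.2, map_smul, smul_mul_assoc] }
  have hS : IsClosed (S : Set C(𝕋, ℂ)) := by
    have h1 : IsClosed {f : C(𝕋, ℂ) | f * g ∈ discAlgebra} :=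
      isClosed_discAlgebra.preimage (continuous_id.mul continuous_const)
    have h2 : IsClosed {f : C(𝕋, ℂ) | meanL (f * g) = meanL f * meanL g} :=
      isClosed_eq (meanL.continuous.comp (continuous_id.mul continuous_const))
        (meanL.continuous.mul continuous_const)
    exact h1.inter h2
  refine discAlgebra_le_of_isClosed hS (fun n => ⟨?_, ?_⟩) hf
  · rw [mem_discAlgebra_iff] at hg ⊢
    intro k hk
    rw [coeffL_fourier_mul, hg _ (by omega)]
  · rw [meanL_eq_coeffL, coeffL_fourier_mul, coeffL_fourier]
    rcases eq_or_ne n 0 with rfl | hn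
    · simp
    · rw [mem_discAlgebra_iff.1 hg _ (by omega), if_neg (by omega), zero_mul]

lemma discAlgebra_mul_mem {f g : C(𝕋, ℂ)} (hf : f ∈ discAlgebra) (hg : g ∈ discAlgebra) :
    f * g ∈ discAlgebra := (discAlgebra_mul_aux hf hg).1

lemma meanL_mul {f g : C(𝕋, ℂ)} (hf : f ∈ discAlgebra) (hg : g ∈ discAlgebra) :
    meanL (f * g) = meanL f * meanL g := (discAlgebra_mul_aux hf hg).2

lemma one_mem_discAlgebra : (1 : C(𝕋, ℂ)) ∈ discAlgebra := by
  have h1 : (1 : C(𝕋, ℂ)) = fourier ((0 : ℕ) : ℤ) := by ext t; simp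
  rw [h1]; exact fourier_mem_discAlgebra 0

lemma const_mem_discAlgebra (c : ℂ) : (ContinuousMap.const 𝕋 c) ∈ discAlgebra := by
  have : ContinuousMap.const 𝕋 c = c • (1 : C(𝕋, ℂ)) := by ext t; simp
  rw [this]; exact Submodule.smul_mem _ _ one_mem_discAlgebra

lemma discAlgebra_pow_mem {f : C(𝕋, ℂ)} (hf : f ∈ discAlgebra) (n : ℕ) : f ^ n ∈ discAlgebra := by
  induction n with
  | zero => simpa using one_mem_discAlgebra
  | succ n ih => rw [pow_succ]; exact discAlgebra_mul_mem ih hf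

/-- Holomorphic functional calculus in the disc algebra, for functions with values in the right
half-plane. -/
lemma discAlgebra_comp_mem {f k : C(𝕋, ℂ)} (hf : f ∈ discAlgebra) (hpos : ∀ t, 0 < (f t).re)
    {h : ℂ → ℂ} (hh : DifferentiableOn ℂ h {z | 0 < z.re}) (hk : ∀ t, k t = h (f t)) :
    k ∈ discAlgebra := by
  obtain ⟨t₀, -, ht₀⟩ := isCompact_univ.exists_isMinOn Set.univ_nonempty
    (by fun_prop : Continuous fun t => (f t).re).continuousOn
  set δ := (f t₀).re with hδ
  have hδpos : 0 < δ := hpos t₀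
  have hδle : ∀ t, δ ≤ (f t).re := fun t => ht₀ (Set.mem_univ t)
  set c : ℝ := ‖f‖ ^ 2 / δ + δ with hc
  have hcpos : 0 < c := by positivity
  have hball : ∀ t, ‖f t - c‖ ^ 2 < c ^ 2 := by
    intro t
    have h1 : ‖f t - c‖ ^ 2 = ‖f t‖ ^ 2 - 2 * c * (f t).re + c ^ 2 := by
      rw [Complex.sq_norm, Complex.sq_norm, Complex.normSq_apply, Complex.normSq_apply]
      simp; ring
    have h2 : ‖f t‖ ^ 2 ≤ ‖f‖ ^ 2 := by gcongr; exact f.norm_coe_le_norm t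
    have h3 : c * δ ≤ c * (f t).re := by gcongr; exact hδle t
    have h4 : c * δ = ‖f‖ ^ 2 + δ ^ 2 := by rw [hc]; field_simp
    have h5 : 0 ≤ ‖f‖ ^ 2 := by positivity
    nlinarith [sq_pos_of_pos hδpos]
  obtain ⟨t₁, -, ht₁⟩ := isCompact_univ.exists_isMaxOn Set.univ_nonempty
    (by fun_prop : Continuous fun t => ‖f t - c‖).continuousOn
  set r := ‖f t₁ - c‖ with hr
  have hrc : r < c := lt_of_pow_lt_pow_left₀ 2 hcpos.le (hball t₁)
  have hle : ∀ t, ‖f t - c‖ ≤ r := fun t => ht₁ (Set.mem_univ t)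
  obtain ⟨r', hr', hr'c⟩ := exists_between hrc
  obtain ⟨r'', hr'', hr''c⟩ := exists_between hr'c
  have hr'0 : 0 < r' := (norm_nonneg _).trans_lt hr'
  lift r'' to NNReal using (hr'0.trans hr'').le
  have hsub : Metric.closedBall (c : ℂ) r'' ⊆ {z | 0 < z.re} := by
    intro z hz
    rw [Metric.mem_closedBall, dist_eq_norm] at hz
    have h1 := (abs_le.1 (Complex.abs_re_le_norm (z - c))).1
    simp only [Complex.sub_re, Complex.ofReal_re] at h1
    change 0 < z.re
    linarith
  have hps := (hh.mono hsub).hasFPowerSeriesOnBall (R := r'') (by exact_mod_cast hr'0.trans hr'')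
  lift r' to NNReal using hr'0.le
  have hunif := hps.tendstoUniformlyOn (r' := r') (by exact_mod_cast hr'')
  set p := cauchyPowerSeries h (c : ℂ) r'' with hp
  set g : C(𝕋, ℂ) := f - ContinuousMap.const 𝕋 (c : ℂ) with hg
  have hgA : g ∈ discAlgebra := Submodule.sub_mem _ hf (const_mem_discAlgebra _)
  let P : ℕ → C(𝕋, ℂ) := fun n => ∑ i ∈ Finset.range n, p.coeff i • g ^ i
  have hPA : ∀ n, P n ∈ discAlgebra := fun n =>
    Submodule.sum_mem _ fun i _ => Submodule.smul_mem _ _ (discAlgebra_pow_mem hgA i)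
  refine isClosed_discAlgebra.mem_of_tendsto (f := P) (b := atTop) ?_ (Eventually.of_forall hPA)
  rw [ContinuousMap.tendsto_iff_tendstoUniformly, Metric.tendstoUniformly_iff]
  intro ε hε
  filter_upwards [Metric.tendstoUniformlyOn_iff.1 hunif ε hε] with n hn t
  have hmem : g t ∈ Metric.ball (0 : ℂ) r' := by
    rw [mem_ball_zero_iff]; exact (hle t).trans_lt hr'
  have h1 := hn (g t) hmem
  have h2 : (c : ℂ) + g t = f t := by simp [hg]
  rw [h2, ← hk] at h1
  convert h1 using 2
  simp only [P, FormalMultilinearSeries.partialSum, ContinuousMap.sum_apply,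
    ContinuousMap.smul_apply, ContinuousMap.pow_apply, smul_eq_mul]
  refine Finset.sum_congr rfl fun i _ => ?_
  rw [FormalMultilinearSeries.apply_eq_pow_smul_coeff, smul_eq_mul, mul_comm]

/-- Every trigonometric polynomial splits into an analytic and an antianalytic part; an operator
that agrees with `U` on analytic characters and vanishes on the others only sees the former. -/
lemma trigPolynomial_decomposition {V : Type*} [NormedAddCommGroup V] [NormedSpace ℂ V]
    {L U : C(𝕋, ℂ) →L[ℂ] V} (hLU : ∀ m : ℤ, L (fourier m) = if 0 ≤ m then U (fourier m) else 0)
    {t : C(𝕋, ℂ)} (ht : t ∈ Submodule.span ℂ (Set.range (fourier (T := 2 * Real.pi)))) :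
    ∃ g ∈ discAlgebra, ∃ k ∈ discAlgebra, meanL k = 0 ∧ t = g + star k ∧ L t = U g := by
  induction ht using Submodule.span_induction with
  | mem x hx =>
    obtain ⟨m, rfl⟩ := hx
    rcases lt_or_ge m 0 with hm | hm
    · refine ⟨0, zero_mem _, fourier ((-m).toNat : ℤ), fourier_mem_discAlgebra _, ?_, ?_, ?_⟩
      · rw [meanL_eq_coeffL, coeffL_fourier, if_neg (by omega)]
      · rw [Int.toNat_of_nonneg (by omega)]
        ext t; simp
      · rw [hLU, if_neg (by omega), map_zero]
    · refine ⟨fourier m, ?_, 0, zero_mem _, map_zero _, by simp, by rw [hLU, if_pos hm]⟩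
      have := fourier_mem_discAlgebra m.toNat
      rwa [Int.toNat_of_nonneg hm] at this
  | zero => exact ⟨0, zero_mem _, 0, zero_mem _, map_zero _, by simp, by simp⟩
  | add x y _ _ hx hy =>
    obtain ⟨g, hg, k, hk, h0, rfl, hL⟩ := hx
    obtain ⟨g', hg', k', hk', h0', rfl, hL'⟩ := hy
    exact ⟨g + g', add_mem hg hg', k + k', add_mem hk hk', by simp [h0, h0'], by
      rw [star_add]; abel, by rw [map_add, hL, hL', map_add]⟩
  | smul c x _ hx =>
    obtain ⟨g, hg, k, hk, h0, rfl, hL⟩ := hx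
    exact ⟨c • g, Submodule.smul_mem _ _ hg, conj c • k, Submodule.smul_mem _ _ hk, by simp [h0],
      by rw [star_smul, smul_add]; simp, by rw [map_smul, hL, map_smul]⟩

lemma integral_sq_norm_le_of_mem_discAlgebra {B : C(𝕋, ℂ)} (hB : B ∈ discAlgebra)
    (h : (meanL B).im = 0) : ∫ t, ‖B t‖ ^ 2 ∂𝔪 ≤ 2 * ∫ t, (B t).re ^ 2 ∂𝔪 := by
  have h1 : (∫ t, (B t) ^ 2 ∂𝔪).re = ((meanL B) ^ 2).re := by
    rw [sq (meanL B), ← meanL_mul hB hB, meanL_apply]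
    simp [sq]
  have h2 : 0 ≤ ((meanL B) ^ 2).re := by
    rw [sq, Complex.mul_re, h]; nlinarith [sq_nonneg (meanL B).re]
  have h3 : (∫ t, (B t) ^ 2 ∂𝔪).re = ∫ t, ((B t) ^ 2).re ∂𝔪 :=
    (integral_re (𝕜 := ℂ)
      (by fun_prop : Continuous fun t => (B t) ^ 2).integrable_haarAddCircle).symm
  have h4 : ∫ t, ‖B t‖ ^ 2 ∂𝔪 + ∫ t, ((B t) ^ 2).re ∂𝔪 = 2 * ∫ t, (B t).re ^ 2 ∂𝔪 := by
    rw [← integral_add (Continuous.integrable_haarAddCircle (by fun_prop))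
      (Continuous.integrable_haarAddCircle (by fun_prop)), ← integral_const_mul]
    congr 1
    ext t
    rw [Complex.sq_norm, Complex.normSq_apply, sq (B t), Complex.mul_re]
    ring
  linarith

/-- Any continuous real function is uniformly close to the real part of a function of the disc
algebra whose imaginary part is controlled in `L²`. -/
lemma exists_discAlgebra_re_near (w : C(𝕋, ℝ)) {η : ℝ} (hη : 0 < η) :
    ∃ B ∈ discAlgebra, (∀ t, |(B t).re - w t| ≤ η) ∧
      ∫ t, ‖B t‖ ^ 2 ∂𝔪 ≤ 2 * ∫ t, (B t).re ^ 2 ∂𝔪 := by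
  let wc : C(𝕋, ℂ) := ⟨fun t => (w t : ℂ), by fun_prop⟩
  have hcl : wc ∈ closure (Submodule.span ℂ (Set.range (fourier (T := 2 * Real.pi))) :
      Set C(𝕋, ℂ)) := by
    rw [← Submodule.topologicalClosure_coe, span_fourier_closure_eq_top]; trivial
  obtain ⟨p, hp, hwp⟩ := Metric.mem_closure_iff.1 hcl η hη
  obtain ⟨g, hg, k, hk, -, rfl, -⟩ :=
    trigPolynomial_decomposition (L := (0 : C(𝕋, ℂ) →L[ℂ] ℂ)) (U := 0) (by simp) hp
  set B := g + k - ContinuousMap.const 𝕋 (Complex.I * (meanL (g + k)).im) with hB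
  have hBA : B ∈ discAlgebra := Submodule.sub_mem _ (add_mem hg hk) (const_mem_discAlgebra _)
  refine ⟨B, hBA, fun t => ?_, integral_sq_norm_le_of_mem_discAlgebra hBA ?_⟩
  · have h1 : (B t).re - w t = ((g + star k) t - wc t).re := by simp [hB, wc]
    rw [h1]
    refine (Complex.abs_re_le_norm _).trans ?_
    rw [← dist_eq_norm, dist_comm]
    exact (ContinuousMap.dist_apply_le_dist t).trans hwp.le
  · have h1 : meanL (ContinuousMap.const 𝕋 (Complex.I * (meanL (g + k)).im)) =
        Complex.I * (meanL (g + k)).im := by simp [meanL_apply]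
    rw [hB, map_sub, h1]
    simp

/-- Boundedness of the Riesz projection in `L⁴`. -/
lemma integral_pow_four_le {g k : C(𝕋, ℂ)} (hg : g ∈ discAlgebra) (hk : k ∈ discAlgebra)
    (h0 : meanL k = 0) :
    ∫ t, ‖g t‖ ^ 4 ∂𝔪 ≤ 48 * ∫ t, ‖(g + star k) t‖ ^ 4 ∂𝔪 := by
  have hz : ∫ t, (g t) ^ 2 * (k t) ^ 2 ∂𝔪 = 0 := by
    have h1 : meanL ((g * g * k) * k) = 0 := by
      rw [meanL_mul (discAlgebra_mul_mem (discAlgebra_mul_mem hg hg) hk) hk, h0, mul_zero]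
    rw [meanL_apply] at h1
    rw [← h1]
    congr 1; ext t; simp; ring
  have hre : ∫ t, ((g t) ^ 2 * (k t) ^ 2).re ∂𝔪 = 0 := by
    have := integral_re (𝕜 := ℂ) (μ := 𝔪)
      (by fun_prop : Continuous fun t => (g t) ^ 2 * (k t) ^ 2).integrable_haarAddCircle
    simp only [RCLike.re_to_complex] at this
    rw [this, hz]; simp
  have hpt : ∀ t, ‖g t‖ ^ 4 ≤ 2 * ((g t) ^ 2 * (k t) ^ 2).re + 48 * ‖(g + star k) t‖ ^ 4 := by
    intro t
    set a := g t with ha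
    set f := (g + star k) t with hf
    have hkf : k t = conj f - conj a := by simp [hf, ha]
    have h1 : a ^ 2 * (k t) ^ 2 =
        (‖a‖ : ℂ) ^ 4 + (a ^ 2 * conj f ^ 2 - 2 * (a ^ 2 * conj a * conj f)) := by
      have : (‖a‖ : ℂ) ^ 4 = a ^ 2 * (conj a) ^ 2 := by
        rw [← mul_pow, Complex.mul_conj, Complex.normSq_eq_norm_sq]; push_cast; ring
      rw [this, hkf]; ring
    have h2 : ‖a ^ 2 * conj f ^ 2 - 2 * (a ^ 2 * conj a * conj f)‖ ≤
        ‖a‖ ^ 2 * ‖f‖ ^ 2 + 2 * (‖a‖ ^ 3 * ‖f‖) := by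
      refine (norm_sub_le _ _).trans (le_of_eq ?_)
      simp only [norm_mul, norm_pow, RCLike.norm_conj, RCLike.norm_ofNat]
      ring
    have h3 := (abs_le.1 (Complex.abs_re_le_norm
      (a ^ 2 * conj f ^ 2 - 2 * (a ^ 2 * conj a * conj f)))).1
    have h4 : ((‖a‖ : ℂ) ^ 4).re = ‖a‖ ^ 4 := by
      rw [← Complex.ofReal_pow, Complex.ofReal_re]
    rw [h1, Complex.add_re, h4]
    have h5 : ‖a‖ ^ 2 * ‖f‖ ^ 2 + 2 * (‖a‖ ^ 3 * ‖f‖) ≤ 1 / 2 * ‖a‖ ^ 4 + 24 * ‖f‖ ^ 4 := by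
      have hx := norm_nonneg a
      have hy := norm_nonneg f
      generalize ‖a‖ = x at *
      generalize ‖f‖ = y at *
      nlinarith [sq_nonneg (x ^ 2 - 3 * x * y), sq_nonneg (x ^ 2 - 2 * x * y),
        sq_nonneg (x ^ 2 - 4 * x * y), sq_nonneg (x * y - 4 * y ^ 2),
        sq_nonneg (x * y - 3 * y ^ 2), sq_nonneg (x ^ 2 - 2 * x * y - 4 * y ^ 2),
        sq_nonneg (x ^ 2 - 2 * x * y - 5 * y ^ 2), sq_nonneg (y ^ 2)]
    linarith
  calc ∫ t, ‖g t‖ ^ 4 ∂𝔪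
      ≤ ∫ t, (2 * ((g t) ^ 2 * (k t) ^ 2).re + 48 * ‖(g + star k) t‖ ^ 4) ∂𝔪 :=
        integral_mono (Continuous.integrable_haarAddCircle (by fun_prop))
          (Continuous.integrable_haarAddCircle (by fun_prop)) hpt
    _ = 48 * ∫ t, ‖(g + star k) t‖ ^ 4 ∂𝔪 := by
        rw [integral_add (Continuous.integrable_haarAddCircle (by fun_prop))
          (Continuous.integrable_haarAddCircle (by fun_prop)), integral_const_mul,
          integral_const_mul, hre]
        ring

section Khinchine

/-- The average of `h (± y₁ ± ⋯ ± yₙ)` over all choices of signs. -/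
def signAverage {V : Type*} [AddCommGroup V] : List V → (V → ℝ) → ℝ
  | [], h => h 0
  | y :: l, h => signAverage l fun s => (h (s + y) + h (s - y)) / 2

variable {V : Type*} [AddCommGroup V]

lemma signAverage_mono (l : List V) {h h' : V → ℝ} (hh : ∀ s, h s ≤ h' s) :
    signAverage l h ≤ signAverage l h' := by
  induction l generalizing h h' with
  | nil => exact hh 0
  | cons y l ih => exact ih fun s => by linarith [hh (s + y), hh (s - y)]

lemma signAverage_linear (l : List V) (a b : ℝ) (h h' : V → ℝ) :
    signAverage l (fun s => a * h s + b * h' s) =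
      a * signAverage l h + b * signAverage l h' := by
  induction l generalizing h h' with
  | nil => rfl
  | cons y l ih =>
    simp only [signAverage]
    rw [← ih]
    congr 1; ext s; ring

lemma signAverage_const (l : List V) (c : ℝ) : signAverage l (fun _ => c) = c := by
  induction l with
  | nil => rfl
  | cons y l ih =>
    simp only [signAverage, add_self_div_two]
    exact ih

lemma signAverage_map {W : Type*} [AddCommGroup W] (L : V →+ W) (l : List V) (h : W → ℝ) :
    signAverage (l.map L) h = signAverage l (fun s => h (L s)) := by
  induction l generalizing h with
  | nil => simp [signAverage]
  | cons y l ih => simp [signAverage, ih]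

lemma continuous_signAverage {X : Type*} [TopologicalSpace X] (l : List V) {h : V → X → ℝ}
    (hh : ∀ s, Continuous (h s)) : Continuous fun t => signAverage l (fun s => h s t) := by
  induction l generalizing h with
  | nil => exact hh 0
  | cons y l ih => exact ih fun s => ((hh (s + y)).add (hh (s - y))).div_const 2

lemma integral_signAverage (l : List V) {h : V → 𝕋 → ℝ} (hh : ∀ s, Continuous (h s)) :
    ∫ t, signAverage l (fun s => h s t) ∂𝔪 = signAverage l (fun s => ∫ t, h s t ∂𝔪) := by
  induction l generalizing h with
  | nil => rfl
  | cons y l ih =>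
    simp only [signAverage]
    rw [ih (h := fun s t => (h (s + y) t + h (s - y) t) / 2)
      fun s => ((hh (s + y)).add (hh (s - y))).div_const 2]
    congr 1; ext s
    rw [integral_div, integral_add (hh _).integrable_haarAddCircle (hh _).integrable_haarAddCircle]

variable {E : Type*} [NormedAddCommGroup E] [InnerProductSpace ℂ E]

lemma signAverage_norm_sq (l : List E) :
    signAverage l (fun s => ‖s‖ ^ 2) = (l.map fun y => ‖y‖ ^ 2).sum := by
  induction l with
  | nil => simp [signAverage]
  | cons y l ih =>
    have h : ∀ s : E, (‖s + y‖ ^ 2 + ‖s - y‖ ^ 2) / 2 = 1 * ‖s‖ ^ 2 + ‖y‖ ^ 2 * 1 := by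
      intro s
      have := parallelogram_law_with_norm ℂ s y
      linarith
    simp only [signAverage, h, List.map_cons, List.sum_cons]
    rw [signAverage_linear, ih, signAverage_const]
    ring

lemma signAverage_norm_pow_four_le (l : List E) :
    signAverage l (fun s => ‖s‖ ^ 4) ≤ 3 * (l.map fun y => ‖y‖ ^ 2).sum ^ 2 := by
  induction l with
  | nil => simp [signAverage]
  | cons y l ih =>
    have h : ∀ s : E, (‖s + y‖ ^ 4 + ‖s - y‖ ^ 4) / 2 ≤
        1 * ‖s‖ ^ 4 + 1 * ((6 * ‖y‖ ^ 2) * ‖s‖ ^ 2 + ‖y‖ ^ 4 * 1) := by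
      intro s
      have h1 := norm_add_sq (𝕜 := ℂ) s y
      have h2 := norm_sub_sq (𝕜 := ℂ) s y
      have h3 := (RCLike.abs_re_le_norm (inner ℂ s y)).trans (norm_inner_le_norm s y)
      have h4 : (RCLike.re (inner ℂ s y)) ^ 2 ≤ (‖s‖ * ‖y‖) ^ 2 := sq_le_sq' (abs_le.1 h3).1
        (abs_le.1 h3).2
      have h5 : ‖s + y‖ ^ 4 = (‖s + y‖ ^ 2) ^ 2 := by ring
      have h6 : ‖s - y‖ ^ 4 = (‖s - y‖ ^ 2) ^ 2 := by ring
      rw [h5, h6, h1, h2]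
      nlinarith
    refine (signAverage_mono l h).trans ?_
    rw [signAverage_linear, signAverage_linear, signAverage_const, signAverage_norm_sq]
    simp only [List.map_cons, List.sum_cons]
    nlinarith [sq_nonneg (‖y‖ ^ 2)]

/-- Khinchine's inequality in `L¹`. -/
lemma sqrt_sum_sq_le_signAverage (l : List E) :
    √((l.map fun y => ‖y‖ ^ 2).sum) ≤ 2 * signAverage l (fun s => ‖s‖) := by
  set S := (l.map fun y => ‖y‖ ^ 2).sum with hS
  have hS0 : 0 ≤ S := List.sum_nonneg (by simp)
  set r := √S with hr
  have hrS : r ^ 2 = S := Real.sq_sqrt hS0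
  rcases (Real.sqrt_nonneg S).eq_or_lt with h0 | h0
  · rw [hr, ← h0]
    have := signAverage_mono l (h := fun _ => 0) (h' := fun s : E => ‖s‖) fun s => norm_nonneg s
    rw [signAverage_const] at this
    linarith
  · have hpt : ∀ s : E, r⁻¹ * ‖s‖ ^ 2 + (-(r⁻¹ ^ 3 / 6)) * ‖s‖ ^ 4 ≤ ‖s‖ := by
      intro s
      set a := r⁻¹ * ‖s‖ with ha
      have ha0 : 0 ≤ a := by positivity
      have has : ‖s‖ = r * a := by rw [ha, ← mul_assoc, mul_inv_cancel₀ h0.ne', one_mul]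
      have h1 : a ^ 2 - a ^ 4 / 6 ≤ a := by
        have : 0 ≤ a * (1 - a + a ^ 3 / 6) := by
          refine mul_nonneg ha0 ?_
          nlinarith [mul_nonneg ha0 (sq_nonneg (a - 3 / 2)), sq_nonneg (a - 3 / 2),
            mul_nonneg ha0 (sq_nonneg (a - 7 / 5)), sq_nonneg (a - 7 / 5)]
        nlinarith
      have h2 : r⁻¹ * ‖s‖ ^ 2 + (-(r⁻¹ ^ 3 / 6)) * ‖s‖ ^ 4 = r * (a ^ 2 - a ^ 4 / 6) := by
        rw [has]; field_simp; ring
      rw [h2, has]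
      exact mul_le_mul_of_nonneg_left h1 h0.le
    have h1 := signAverage_mono l hpt
    rw [signAverage_linear, signAverage_norm_sq, ← hS, ← hrS] at h1
    have h2 := signAverage_norm_pow_four_le l
    rw [← hS, ← hrS] at h2
    have h3 : r⁻¹ ^ 3 / 6 * signAverage l (fun s => ‖s‖ ^ 4) ≤ r⁻¹ ^ 3 / 6 * (3 * (r ^ 2) ^ 2) := by
      gcongr
    have h4 : r⁻¹ ^ 3 / 6 * (3 * (r ^ 2) ^ 2) = r / 2 := by field_simp; ring
    have h5 : r⁻¹ * r ^ 2 = r := by field_simp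
    linarith

end Khinchine

section LittleGrothendieck

variable {V : Type*} [NormedAddCommGroup V] [InnerProductSpace ℂ V]

lemma integral_norm_inner_le [CompleteSpace V] {Φ : C(𝕋, V)} {γ : ℝ} (hγ : 0 < γ)
    (h : ∀ f, ‖densityOp Φ f‖ ≤ γ * ‖f‖) (x : V) :
    ∫ t, ‖inner ℂ (Φ t) x‖ ∂𝔪 ≤ γ * ‖x‖ := by
  refine le_of_forall_pos_le_add fun ε hε => ?_
  set s : C(𝕋, ℂ) := ⟨fun t => inner ℂ (Φ t) x, by fun_prop⟩ with hs
  have hpos : ∀ t, 0 < ‖s t‖ + ε := fun t => by positivity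
  let f : C(𝕋, ℂ) := ⟨fun t => s t / ((‖s t‖ + ε : ℝ) : ℂ), by
    refine Continuous.div (by fun_prop) (by fun_prop) fun t => ?_
    exact_mod_cast (hpos t).ne'⟩
  have hf : ‖f‖ ≤ 1 := by
    rw [ContinuousMap.norm_le _ zero_le_one]
    intro t
    change ‖s t / ((‖s t‖ + ε : ℝ) : ℂ)‖ ≤ 1
    rw [norm_div, Complex.norm_real, Real.norm_of_nonneg (hpos t).le, div_le_one (hpos t)]
    linarith
  have h1 : inner ℂ x (densityOp Φ f) = ∫ t, (((‖s t‖ ^ 2 / (‖s t‖ + ε) : ℝ)) : ℂ) ∂𝔪 := by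
    rw [densityOp_apply, ← integral_inner
      (by fun_prop : Continuous fun t => f t • Φ t).integrable_haarAddCircle]
    congr 1
    ext t
    rw [inner_smul_right, ← inner_conj_symm]
    change s t / ((‖s t‖ + ε : ℝ) : ℂ) * conj (s t) = _
    rw [div_mul_eq_mul_div, Complex.mul_conj, Complex.normSq_eq_norm_sq]
    push_cast; rfl
  rw [integral_complex_ofReal] at h1
  have hc : Continuous fun t => ‖s t‖ ^ 2 / (‖s t‖ + ε) :=
    Continuous.div (by fun_prop) (by fun_prop) fun t => (hpos t).ne'
  have h2 : ∫ t, ‖s t‖ ^ 2 / (‖s t‖ + ε) ∂𝔪 ≤ γ * ‖x‖ := by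
    have h3 := (Complex.abs_re_le_norm _).trans (norm_inner_le_norm (𝕜 := ℂ) x (densityOp Φ f))
    rw [h1, Complex.ofReal_re] at h3
    refine (le_abs_self _).trans (h3.trans ?_)
    rw [mul_comm γ]
    refine mul_le_mul_of_nonneg_left ((h f).trans ?_) (norm_nonneg _)
    nlinarith
  have h4 : ∫ t, ‖s t‖ ∂𝔪 ≤ ∫ t, (‖s t‖ ^ 2 / (‖s t‖ + ε) + ε) ∂𝔪 := by
    refine integral_mono (Continuous.integrable_haarAddCircle (by fun_prop))
      (hc.add continuous_const).integrable_haarAddCircle fun t => ?_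
    change ‖s t‖ ≤ ‖s t‖ ^ 2 / (‖s t‖ + ε) + ε
    rw [← sub_le_iff_le_add, le_div_iff₀ (hpos t)]
    nlinarith [sq_nonneg ε]
  rw [integral_add hc.integrable_haarAddCircle (integrable_const _)] at h4
  simp only [integral_const, probReal_univ, one_smul] at h4
  change ∫ t, ‖s t‖ ∂𝔪 ≤ _
  linarith

lemma integral_sqrt_sum_inner_le [CompleteSpace V] {Φ : C(𝕋, V)} {γ : ℝ} (hγ : 0 < γ)
    (h : ∀ f, ‖densityOp Φ f‖ ≤ γ * ‖f‖) {ι : Type*} [Fintype ι] (y : ι → V)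
    (hy : ∑ i, ‖y i‖ ^ 2 ≤ 1) :
    ∫ t, √(∑ i, ‖inner ℂ (Φ t) (y i)‖ ^ 2) ∂𝔪 ≤ 2 * γ := by
  set l := Finset.univ.toList.map y with hl
  have hpt : ∀ t, √(∑ i, ‖inner ℂ (Φ t) (y i)‖ ^ 2) ≤
      2 * signAverage l (fun s => ‖inner ℂ (Φ t) s‖) := by
    intro t
    have h1 := sqrt_sum_sq_le_signAverage (l.map (innerSL ℂ (Φ t)).toLinearMap.toAddMonoidHom)
    rw [signAverage_map] at h1
    simpa [hl, Function.comp_def, Finset.sum_map_toList] using h1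
  have hc : ∀ s, Continuous fun t => ‖inner ℂ (Φ t) s‖ := fun s => by fun_prop
  calc ∫ t, √(∑ i, ‖inner ℂ (Φ t) (y i)‖ ^ 2) ∂𝔪
      ≤ ∫ t, 2 * signAverage l (fun s => ‖inner ℂ (Φ t) s‖) ∂𝔪 :=
        integral_mono (Continuous.integrable_haarAddCircle (by fun_prop))
          (continuous_const.mul (continuous_signAverage l hc)).integrable_haarAddCircle hpt
    _ = 2 * signAverage l (fun s => ∫ t, ‖inner ℂ (Φ t) s‖ ∂𝔪) := by
        rw [integral_const_mul, integral_signAverage l hc]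
    _ ≤ 2 * signAverage l (fun s => γ / 2 * ‖s‖ ^ 2 + γ / 2 * 1) := by
        gcongr
        refine signAverage_mono l fun s => (integral_norm_inner_le hγ h s).trans ?_
        nlinarith [mul_nonneg hγ.le (sq_nonneg (‖s‖ - 1))]
    _ ≤ 2 * γ := by
        rw [signAverage_linear, signAverage_norm_sq, signAverage_const]
        have : (l.map fun y => ‖y‖ ^ 2).sum = ∑ i, ‖y i‖ ^ 2 := by
          simp [hl, Function.comp_def, Finset.sum_map_toList]
        rw [this]
        nlinarith

/-- The real quadratic form of an operator, `v ↦ Re ⟪v, T v⟫`, depends continuously on `T`. -/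
lemma continuous_re_inner_apply (Φ : C(𝕋, V)) :
    Continuous fun p : (V →L[ℂ] V) × 𝕋 => (inner ℂ (Φ p.2) (p.1 (Φ p.2))).re := by
  fun_prop

lemma re_inner_rankOne (x v : V) :
    (inner ℂ v (InnerProductSpace.rankOne ℂ x x v)).re = ‖inner ℂ v x‖ ^ 2 := by
  rw [InnerProductSpace.rankOne_apply, inner_smul_right, ← inner_conj_symm x v, mul_comm,
    Complex.mul_conj, Complex.normSq_eq_norm_sq, Complex.ofReal_re]

lemma sqrt_add_ge {a h : ℝ} (ha : 0 < a) (hah : 0 ≤ a + h) :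
    √a + h / (2 * √a) - h ^ 2 / (2 * (a * √a)) ≤ √(a + h) := by
  have hr : 0 < √a := Real.sqrt_pos.2 ha
  set r := √a with hrdef
  have har : a = r ^ 2 := (Real.sq_sqrt ha.le).symm
  set z := h / a with hz
  have hhz : h = r ^ 2 * z := by rw [hz, ← har]; field_simp
  have hz1 : 0 ≤ 1 + z := by
    have : a + h = a * (1 + z) := by rw [hz]; field_simp
    rw [this] at hah
    exact nonneg_of_mul_nonneg_right hah ha
  have h1 : √(a + h) = r * √(1 + z) := by
    rw [show a + h = a * (1 + z) by rw [hz]; field_simp, Real.sqrt_mul ha.le]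
  have h2 : r + h / (2 * r) - h ^ 2 / (2 * (a * r)) = r * (1 + z / 2 - z ^ 2 / 2) := by
    rw [hhz, har]; field_simp
  rw [h1, h2]
  refine mul_le_mul_of_nonneg_left ?_ hr.le
  rcases le_or_gt z 3 with h3 | h3
  · refine Real.le_sqrt_of_sq_le ?_
    nlinarith [mul_nonneg (mul_nonneg hz1 (sq_nonneg z)) (sub_nonneg.2 h3)]
  · refine le_trans ?_ (Real.sqrt_nonneg _)
    nlinarith

/-- **Little Grothendieck theorem** (dual form): an operator with continuous density factors
through a weighted `L²` norm. -/
theorem exists_littleGrothendieck_weight [FiniteDimensional ℂ V] {Φ : C(𝕋, V)} {γ : ℝ}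
    (hγ : 0 < γ) (h : ∀ f, ‖densityOp Φ f‖ ≤ γ * ‖f‖) :
    ∃ D : C(𝕋, ℝ), (∀ t, 0 < D t) ∧ ∫ t, D t ∂𝔪 ≤ 3 * γ ∧
      ∀ x, ∫ t, ‖inner ℂ (Φ t) x‖ ^ 2 / D t ∂𝔪 ≤ 3 * γ * ‖x‖ ^ 2 := by
  set S : Set (V →L[ℂ] V) := (fun x : V => InnerProductSpace.rankOne ℂ x x) ''
    Metric.closedBall 0 1 with hS
  set K := closure (convexHull ℝ S) with hK
  have : CompleteSpace V := FiniteDimensional.complete ℂ V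
  have : ProperSpace V := FiniteDimensional.proper ℂ V
  have : ProperSpace (V →L[ℂ] V) := FiniteDimensional.proper ℂ _
  have hSc : IsCompact S := (isCompact_closedBall _ _).image
    (((ContinuousLinearMap.smulRightL ℂ V V).continuous.comp
      (innerSL ℂ).continuous).clm_apply continuous_id)
  have hKc : IsCompact K := (isBounded_convexHull.2 hSc.isBounded).isCompact_closure
  have hKconv : Convex ℝ K := (convex_convexHull ℝ S).closure
  have hSK : S ⊆ K := (subset_convexHull ℝ S).trans subset_closure
  let q : (V →L[ℂ] V) → 𝕋 → ℝ := fun T t => (inner ℂ (Φ t) (T (Φ t))).re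
  have hqc : Continuous fun p : (V →L[ℂ] V) × 𝕋 => q p.1 p.2 := continuous_re_inner_apply Φ
  have hq_add : ∀ T R t, q (T + R) t = q T t + q R t := fun T R t => by
    simp [q]
  have hq_smul : ∀ (c : ℝ) T t, q (c • T) t = c * q T t := fun c T t => by
    simp [q, inner_smul_right_eq_smul]
  have hq0 : ∀ T ∈ K, ∀ t, 0 ≤ q T t := by
    intro T hT t
    have hcl : IsClosed {T | 0 ≤ q T t} :=
      isClosed_le continuous_const (hqc.comp (by fun_prop : Continuous fun T => (T, t)))
    have hcv : Convex ℝ {T | 0 ≤ q T t} := by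
      intro T hT R hR a b ha hb _
      simp only [Set.mem_ofPred_eq] at *
      rw [hq_add, hq_smul, hq_smul]
      positivity
    refine closure_minimal (convexHull_min ?_ hcv) hcl hT
    rintro _ ⟨x, -, rfl⟩
    simp only [Set.mem_ofPred_eq, q, re_inner_rankOne]
    positivity
  let J : (V →L[ℂ] V) → ℝ := fun T => ∫ t, √(γ ^ 2 + q T t) ∂𝔪
  have hrc : Continuous fun p : (V →L[ℂ] V) × 𝕋 => √(γ ^ 2 + q p.1 p.2) :=
    (continuous_const.add hqc).sqrt
  have hqt : ∀ T, Continuous (q T) := fun T => hqc.comp (by fun_prop : Continuous fun t => (T, t))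
  have hrt : ∀ T, Continuous fun t => √(γ ^ 2 + q T t) := fun T =>
    hrc.comp (by fun_prop : Continuous fun t => (T, t))
  have hJc : Continuous J := by
    simpa [J] using continuous_parametric_integral_of_continuous (μ := 𝔪)
      (f := fun T t => √(γ ^ 2 + q T t)) hrc isCompact_univ
  have hJle : ∀ T ∈ K, J T ≤ 3 * γ := by
    intro T hT
    refine closure_minimal (t := {T | J T ≤ 3 * γ}) ?_ (isClosed_le hJc continuous_const) hT
    intro T hT
    obtain ⟨ι, _, w, z, hw0, hw1, hz, rfl⟩ := mem_convexHull_iff_exists_fintype.1 hT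
    choose x hx hxz using hz
    have hqs : ∀ t, q (∑ i, w i • z i) t = ∑ i, ‖inner ℂ (Φ t) ((√(w i) : ℂ) • x i)‖ ^ 2 := by
      intro t
      have : q (∑ i, w i • z i) t = ∑ i, w i * q (z i) t := by
        simp_rw [← hq_smul]
        simp [q]
      rw [this]
      refine Finset.sum_congr rfl fun i _ => ?_
      rw [← hxz i]
      simp only [q, re_inner_rankOne, inner_smul_right, norm_mul, mul_pow, Complex.norm_real]
      rw [Real.norm_of_nonneg (Real.sqrt_nonneg _), Real.sq_sqrt (hw0 i)]
    have h1 := integral_sqrt_sum_inner_le hγ h (fun i => (√(w i) : ℂ) • x i) (by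
      rw [← hw1]
      refine Finset.sum_le_sum fun i _ => ?_
      rw [norm_smul, Complex.norm_real, Real.norm_of_nonneg (Real.sqrt_nonneg _), mul_pow,
        Real.sq_sqrt (hw0 i)]
      have := mem_closedBall_zero_iff.1 (hx i)
      exact mul_le_of_le_one_right (hw0 i) (pow_le_one₀ (norm_nonneg _) this))
    simp_rw [← hqs] at h1
    have hqi : Continuous fun t => √(q (∑ i, w i • z i) t) := (hqt _).sqrt
    calc J _ ≤ ∫ t, (γ + √(q (∑ i, w i • z i) t)) ∂𝔪 := by
          refine integral_mono (hrt _).integrable_haarAddCircle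
            (continuous_const.add hqi).integrable_haarAddCircle fun t => ?_
          have h0 : 0 ≤ q (∑ i, w i • z i) t := by rw [hqs]; positivity
          refine (Real.sqrt_le_left (by positivity)).2 ?_
          nlinarith [Real.sq_sqrt h0, Real.sqrt_nonneg (q (∑ i, w i • z i) t)]
      _ = γ + ∫ t, √(q (∑ i, w i • z i) t) ∂𝔪 := by
          rw [integral_add (integrable_const _) hqi.integrable_haarAddCircle]
          simp
      _ ≤ 3 * γ := by linarith
  have hKne : K.Nonempty := ⟨_, hSK ⟨0, by simp, rfl⟩⟩
  obtain ⟨T, hTK, hTmax⟩ := hKc.exists_isMaxOn hKne hJc.continuousOn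
  have hapos : ∀ t, 0 < γ ^ 2 + q T t := fun t => by have := hq0 T hTK t; positivity
  have hrpos : ∀ t, 0 < √(γ ^ 2 + q T t) := fun t => Real.sqrt_pos.2 (hapos t)
  refine ⟨⟨fun t => √(γ ^ 2 + q T t), hrt T⟩, hrpos, hJle T hTK, ?_⟩
  have hunit : ∀ x : V, ‖x‖ ≤ 1 →
      ∫ t, ‖inner ℂ (Φ t) x‖ ^ 2 / √(γ ^ 2 + q T t) ∂𝔪 ≤ 3 * γ := by
    intro x hx
    set R := InnerProductSpace.rankOne ℂ x x with hR
    have hRK : R ∈ K := hSK ⟨x, by simpa using hx, rfl⟩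
    have hqR : ∀ t, q R t = ‖inner ℂ (Φ t) x‖ ^ 2 := fun t => re_inner_rankOne x (Φ t)
    set d : 𝕋 → ℝ := fun t => q R t - q T t with hd
    have hdc : Continuous d := (hqt R).sub (hqt T)
    have hX : Continuous fun t => d t / √(γ ^ 2 + q T t) :=
      hdc.div (hrt T) fun t => (hrpos t).ne'
    have hY : Continuous fun t => d t ^ 2 / ((γ ^ 2 + q T t) * √(γ ^ 2 + q T t)) :=
      (hdc.pow 2).div ((continuous_const.add (hqt T)).mul (hrt T))
        fun t => (mul_pos (hapos t) (hrpos t)).ne'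
    set X := ∫ t, d t / √(γ ^ 2 + q T t) ∂𝔪 with hXdef
    set Y := ∫ t, d t ^ 2 / ((γ ^ 2 + q T t) * √(γ ^ 2 + q T t)) ∂𝔪 with hYdef
    have hs : ∀ s : ℝ, 0 < s → s ≤ 1 → X ≤ s * Y := by
      intro s hs0 hs1
      set Ts := (1 - s) • T + s • R with hTs
      have hTsK : Ts ∈ K := hKconv hTK hRK (by linarith) hs0.le (by ring)
      have hqs : ∀ t, γ ^ 2 + q Ts t = γ ^ 2 + q T t + s * d t := by
        intro t
        rw [hTs, hq_add, hq_smul, hq_smul, hd]; ring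
      have hW : Continuous fun t => s / 2 * (d t / √(γ ^ 2 + q T t)) + -(s ^ 2 / 2) *
          (d t ^ 2 / ((γ ^ 2 + q T t) * √(γ ^ 2 + q T t))) :=
        (hX.const_mul _).add (hY.const_mul _)
      have h1 : (∫ t, √(γ ^ 2 + q T t) ∂𝔪) + (s / 2 * X + -(s ^ 2 / 2) * Y) ≤ J Ts := by
        rw [hXdef, hYdef, ← integral_const_mul, ← integral_const_mul,
          ← integral_add (hX.const_mul _).integrable_haarAddCircle
            (hY.const_mul _).integrable_haarAddCircle,
          ← integral_add (hrt T).integrable_haarAddCircle hW.integrable_haarAddCircle]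
        refine integral_mono ((hrt T).add hW).integrable_haarAddCircle
          (hrt Ts).integrable_haarAddCircle fun t => ?_
        have h2 := sqrt_add_ge (hapos t) (h := s * d t) (by
          rw [← hqs]; have := hq0 Ts hTsK t; positivity)
        simp only [hqs]
        refine le_trans (le_of_eq ?_) h2
        have := (hrpos t).ne'
        have := (hapos t).ne'
        field_simp
        ring
      have h2 : J Ts ≤ J T := hTmax hTsK
      nlinarith
    have hX0 : X ≤ 0 := by
      by_contra! hXpos
      have h1 := hs 1 one_pos le_rfl
      have hYpos : 0 < Y := by linarith
      have h2 := hs (X / (2 * Y)) (by positivity) (by rw [div_le_one (by positivity)]; linarith)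
      rw [show X / (2 * Y) * Y = X / 2 by field_simp] at h2
      linarith
    have hZ : Continuous fun t => q R t / √(γ ^ 2 + q T t) :=
      (hqt R).div (hrt T) fun t => (hrpos t).ne'
    have h3 : ∫ t, q R t / √(γ ^ 2 + q T t) ∂𝔪 ≤ X + J T := by
      rw [hXdef, ← integral_add hX.integrable_haarAddCircle (hrt T).integrable_haarAddCircle]
      refine integral_mono hZ.integrable_haarAddCircle
        (hX.add (hrt T)).integrable_haarAddCircle fun t => ?_
      have h4 := Real.mul_self_sqrt (hapos t).le
      change q R t / √(γ ^ 2 + q T t) ≤ d t / √(γ ^ 2 + q T t) + √(γ ^ 2 + q T t)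
      rw [div_le_iff₀ (hrpos t), add_mul, div_mul_cancel₀ _ (hrpos t).ne', h4, hd]
      nlinarith
    simp_rw [← hqR]
    exact h3.trans (by linarith [hJle T hTK])
  intro x
  rcases eq_or_ne x 0 with rfl | hx
  · simp
  · have hx' : 0 < ‖x‖ := norm_pos_iff.2 hx
    have h1 := hunit (((‖x‖⁻¹ : ℝ) : ℂ) • x) (by
      rw [norm_smul, Complex.norm_real, norm_inv, norm_norm, inv_mul_cancel₀ hx'.ne'])
    have h2 : ∀ t, ‖inner ℂ (Φ t) (((‖x‖⁻¹ : ℝ) : ℂ) • x)‖ ^ 2 / √(γ ^ 2 + q T t) =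
        (‖x‖ ^ 2)⁻¹ * (‖inner ℂ (Φ t) x‖ ^ 2 / √(γ ^ 2 + q T t)) := by
      intro t
      rw [inner_smul_right, norm_mul, Complex.norm_real, norm_inv, norm_norm]
      ring
    simp_rw [h2] at h1
    rw [integral_const_mul, inv_mul_le_iff₀ (by positivity)] at h1
    exact h1.trans_eq (mul_comm _ _)

/-- An operator with continuous density is bounded by a weighted `L²` norm. -/
theorem exists_weight_norm_sq_le [FiniteDimensional ℂ V] {Φ : C(𝕋, V)} {γ : ℝ}
    (hγ : 0 < γ) (h : ∀ f, ‖densityOp Φ f‖ ≤ γ * ‖f‖) :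
    ∃ D : C(𝕋, ℝ), (∀ t, 0 < D t) ∧ ∫ t, D t ∂𝔪 ≤ 3 * γ ∧
      ∀ f, ‖densityOp Φ f‖ ^ 2 ≤ 3 * γ * ∫ t, ‖f t‖ ^ 2 * D t ∂𝔪 := by
  have : CompleteSpace V := FiniteDimensional.complete ℂ V
  obtain ⟨D, hD0, hD1, hD2⟩ := exists_littleGrothendieck_weight hγ h
  refine ⟨D, hD0, hD1, fun f => ?_⟩
  set y := densityOp Φ f with hy
  have hc1 : Continuous fun t => ‖f t‖ ^ 2 * D t := by fun_prop
  have hc2 : Continuous fun t => ‖inner ℂ (Φ t) y‖ ^ 2 / D t :=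
    Continuous.div (by fun_prop) (by fun_prop) fun t => (hD0 t).ne'
  have h1 : (inner ℂ y y : ℂ) = ∫ t, f t * inner ℂ y (Φ t) ∂𝔪 := by
    simp_rw [← inner_smul_right]
    rw [integral_inner (by fun_prop : Continuous fun t => f t • Φ t).integrable_haarAddCircle]
    rfl
  have h2 : ‖y‖ ^ 2 ≤ ∫ t, ‖f t * inner ℂ y (Φ t)‖ ∂𝔪 := by
    refine le_trans (le_of_eq ?_) (norm_integral_le_integral_norm _)
    rw [← h1, inner_self_eq_norm_sq_to_K]
    simp
  have h3 : ∫ t, ‖f t * inner ℂ y (Φ t)‖ ∂𝔪 ≤ ∫ t, (3 * γ / 2 * (‖f t‖ ^ 2 * D t) +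
      (6 * γ)⁻¹ * (‖inner ℂ (Φ t) y‖ ^ 2 / D t)) ∂𝔪 := by
    refine integral_mono (Continuous.integrable_haarAddCircle (by fun_prop))
      ((continuous_const.mul hc1).add (continuous_const.mul hc2)).integrable_haarAddCircle
      fun t => ?_
    change ‖f t * inner ℂ y (Φ t)‖ ≤ _
    rw [norm_mul, norm_inner_symm y]
    set a := ‖f t‖
    set b := ‖(inner ℂ (Φ t) y : ℂ)‖
    have hd := hD0 t
    have : 3 * γ / 2 * (a ^ 2 * D t) + (6 * γ)⁻¹ * (b ^ 2 / D t) - a * b =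
        (3 * γ * a * D t - b) ^ 2 / (6 * γ * D t) := by
      field_simp; ring
    have h5 : 0 ≤ (3 * γ * a * D t - b) ^ 2 / (6 * γ * D t) := by positivity
    linarith
  rw [integral_add (by fun_prop : Continuous fun t => 3 * γ / 2 *
      (‖f t‖ ^ 2 * D t)).integrable_haarAddCircle
    (hc2.const_mul _).integrable_haarAddCircle, integral_const_mul, integral_const_mul] at h3
  have h6 : (6 * γ)⁻¹ * ∫ t, ‖inner ℂ (Φ t) y‖ ^ 2 / D t ∂𝔪 ≤ ‖y‖ ^ 2 / 2 := by
    rw [inv_mul_le_iff₀ (by positivity)]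
    nlinarith [hD2 y]
  linarith

end LittleGrothendieck

lemma integral_haarAddCircle_mono {f g : 𝕋 → ℝ} (hf : Continuous f) (hg : Continuous g)
    (h : ∀ t, f t ≤ g t) : ∫ t, f t ∂𝔪 ≤ ∫ t, g t ∂𝔪 :=
  integral_mono hf.integrable_haarAddCircle hg.integrable_haarAddCircle h

lemma Complex.abs_im_lt_re_of_sq_re_pos {z : ℂ} (h : 0 < z.re) (h2 : 0 < (z ^ 2).re) :
    |z.im| < z.re := by
  rw [sq, Complex.mul_re] at h2
  exact abs_lt_of_sq_lt_sq (by nlinarith) h.le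

/-- A function in the disc algebra with positive real part has an invertible square root. -/
lemma exists_sqrt_mem_discAlgebra {F : C(𝕋, ℂ)} (hF : F ∈ discAlgebra)
    (hpos : ∀ t, 0 < (F t).re) :
    ∃ G ∈ discAlgebra, ∃ R ∈ discAlgebra, (∀ t, R t * G t = 1) ∧ (∀ t, G t ^ 2 = F t) ∧
      ∀ t, |(G t).im| < (G t).re := by
  have hre : ∀ z : ℂ, 0 < z.re → 0 < (z ^ (2⁻¹ : ℂ)).re := by
    intro z hz
    rw [Complex.cpow_inv_two_re]
    exact Real.sqrt_pos.2 (by have := norm_nonneg z; linarith)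
  have hsq : ∀ z : ℂ, (z ^ (2⁻¹ : ℂ)) ^ 2 = z := fun z => by
    exact_mod_cast Complex.cpow_nat_inv_pow z two_ne_zero
  have hne : ∀ t, F t ^ (2⁻¹ : ℂ) ≠ 0 := fun t h => by
    have := hre _ (hpos t); simp [h] at this
  have hc : Continuous fun t => F t ^ (2⁻¹ : ℂ) :=
    (map_continuous F).cpow continuous_const fun t => Or.inl (hpos t)
  have hd : DifferentiableOn ℂ (fun z : ℂ => z ^ (2⁻¹ : ℂ)) {z | 0 < z.re} := fun z hz =>
    (differentiableAt_id.cpow_const (Or.inl hz)).differentiableWithinAt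
  refine ⟨⟨_, hc⟩, discAlgebra_comp_mem hF hpos hd fun t => rfl,
    ⟨_, hc.inv₀ hne⟩, discAlgebra_comp_mem (h := fun z => (z ^ (2⁻¹ : ℂ))⁻¹) hF hpos
      (hd.inv fun z hz h => ?_) fun t => rfl,
    fun t => inv_mul_cancel₀ (hne t), fun t => hsq _, fun t => ?_⟩
  · have := hre z hz; simp [h] at this
  · refine Complex.abs_im_lt_re_of_sq_re_pos (hre _ (hpos t)) ?_
    change 0 < ((F t ^ (2⁻¹ : ℂ)) ^ 2).re
    rw [hsq]; exact hpos t

/-- Truncation in the disc algebra: an analytic `L⁴(|F|²)` function is the sum of a bounded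
analytic function and an analytic function that is small in `L²(|F|²)`. -/
lemma exists_truncation {F g : C(𝕋, ℂ)} (hF : F ∈ discAlgebra) (hpos : ∀ t, 0 < (F t).re)
    (hg : g ∈ discAlgebra) {M Q : ℝ} (hM : 0 < M) (hQ : 0 < Q)
    (hgQ : ∫ t, ‖g t‖ ^ 4 * ‖F t‖ ^ 2 ∂𝔪 ≤ Q) :
    ∃ g₁ ∈ discAlgebra, ∃ g₂ ∈ discAlgebra, g = g₁ + g₂ ∧ ‖g₁‖ ≤ M ∧
      ∫ t, ‖g₂ t‖ ^ 2 * ‖F t‖ ^ 2 ∂𝔪 ≤ 3 * Q / M ^ 2 := by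
  set η := √Q / (6 * M ^ 2) with hη
  have hη0 : 0 < η := by positivity
  have hη2 : 36 * η ^ 2 = Q / M ^ 4 := by
    rw [hη, div_pow, Real.sq_sqrt hQ.le]; field_simp; norm_num
  obtain ⟨B, hB, hBw, hB2⟩ := exists_discAlgebra_re_near
    ⟨fun t => (‖g t‖ / M) ^ 2 * ‖F t‖ + 2 * η, by fun_prop⟩ hη0
  have hB1 : ∀ t, (‖g t‖ / M) ^ 2 * ‖F t‖ + η ≤ (B t).re := fun t => by
    have := (abs_le.1 (hBw t)).1
    simp only [ContinuousMap.coe_mk] at this; linarith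
  have hB3 : ∀ t, (B t).re ≤ (‖g t‖ / M) ^ 2 * ‖F t‖ + 3 * η := fun t => by
    have := (abs_le.1 (hBw t)).2
    simp only [ContinuousMap.coe_mk] at this; linarith
  have hBpos : ∀ t, 0 < (B t).re := fun t => lt_of_lt_of_le (by positivity) (hB1 t)
  have hBint : ∫ t, ‖B t‖ ^ 2 ∂𝔪 ≤ 5 * Q / M ^ 4 := by
    have h1 : ∫ t, (B t).re ^ 2 ∂𝔪 ≤
        ∫ t, (2 / M ^ 4 * (‖g t‖ ^ 4 * ‖F t‖ ^ 2) + 18 * η ^ 2) ∂𝔪 := by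
      refine integral_haarAddCircle_mono (by fun_prop) (by fun_prop) fun t => ?_
      have h2 : (B t).re ^ 2 ≤ ((‖g t‖ / M) ^ 2 * ‖F t‖ + 3 * η) ^ 2 :=
        pow_le_pow_left₀ (hBpos t).le (hB3 t) 2
      have h3 : 2 / M ^ 4 * (‖g t‖ ^ 4 * ‖F t‖ ^ 2) = 2 * ((‖g t‖ / M) ^ 2 * ‖F t‖) ^ 2 := by
        field_simp
      rw [h3]
      nlinarith [sq_nonneg ((‖g t‖ / M) ^ 2 * ‖F t‖ - 3 * η)]
    rw [integral_add (Continuous.integrable_haarAddCircle (by fun_prop)) (integrable_const _),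
      integral_const_mul] at h1
    simp only [integral_const, probReal_univ, one_smul] at h1
    have h4 : 2 / M ^ 4 * ∫ t, ‖g t‖ ^ 4 * ‖F t‖ ^ 2 ∂𝔪 ≤ 2 / M ^ 4 * Q := by gcongr
    have h5 : 2 / M ^ 4 * Q = 2 * (Q / M ^ 4) := by ring
    have h6 : 5 * Q / M ^ 4 = 5 * (Q / M ^ 4) := by ring
    linarith
  obtain ⟨G, -, R, hR, hRG, hG2, hGim⟩ := exists_sqrt_mem_discAlgebra hF hpos
  obtain ⟨b, hb, -, -, -, hb2, hbim⟩ := exists_sqrt_mem_discAlgebra hB hBpos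
  set E := b * R with hE
  have hEA : E ∈ discAlgebra := discAlgebra_mul_mem hb hR
  have hEG : ∀ t, E t * G t = b t := fun t => by
    rw [hE, ContinuousMap.mul_apply, mul_assoc, hRG, mul_one]
  have hEpos : ∀ t, 0 < (E t).re := by
    intro t
    have hGne : G t ≠ 0 := right_ne_zero_of_mul_eq_one (hRG t)
    have h1 : E t * (Complex.normSq (G t) : ℂ) = b t * conj (G t) := by
      rw [← hEG, ← Complex.mul_conj]; ring
    have h2 : (E t).re * Complex.normSq (G t) = (b t).re * (G t).re + (b t).im * (G t).im := by
      have := congrArg Complex.re h1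
      simpa [Complex.mul_re] using this
    have h3 : 0 < (b t).re * (G t).re + (b t).im * (G t).im := by
      have h4 := abs_lt.1 (hbim t)
      have h5 := abs_lt.1 (hGim t)
      nlinarith
    rw [← h2] at h3
    exact pos_of_mul_pos_left h3 (Complex.normSq_nonneg _)
  have hEF : ∀ t, ‖E t‖ ^ 2 * ‖F t‖ = ‖B t‖ := fun t => by
    rw [← hG2, ← hb2, norm_pow, norm_pow, ← mul_pow, ← norm_mul, hEG]
  have hFn : ∀ t, 0 < ‖F t‖ := fun t => (hpos t).trans_le (Complex.re_le_norm _)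
  have hgE : ∀ t, ‖g t‖ ≤ M * ‖E t‖ := by
    intro t
    have h1 : (‖g t‖ / M) ^ 2 * ‖F t‖ ≤ ‖E t‖ ^ 2 * ‖F t‖ := by
      rw [hEF]; linarith [hB1 t, Complex.re_le_norm (B t)]
    have h2 := le_of_mul_le_mul_right h1 (hFn t)
    have h3 := le_of_sq_le_sq h2 (norm_nonneg _)
    rwa [div_le_iff₀' hM] at h3
  have hne : ∀ t, 1 + E t ≠ 0 := fun t h => by
    have := congrArg Complex.re h
    simp only [Complex.add_re, Complex.one_re, Complex.zero_re] at this
    linarith [hEpos t]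
  have hφc : Continuous fun t => (1 + E t)⁻¹ := Continuous.inv₀ (by fun_prop) hne
  set φ : C(𝕋, ℂ) := ⟨_, hφc⟩ with hφ
  have hφA : φ ∈ discAlgebra := by
    refine discAlgebra_comp_mem (h := fun z => (1 + z)⁻¹) hEA hEpos ?_ fun t => rfl
    refine DifferentiableOn.inv (by fun_prop) fun z hz h => ?_
    have := congrArg Complex.re h
    simp only [Complex.add_re, Complex.one_re, Complex.zero_re] at this
    linarith [show 0 < z.re from hz]
  have hφ1 : ∀ t, φ t * (1 + E t) = 1 := fun t => inv_mul_cancel₀ (hne t)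
  have hn1 : ∀ t, 1 ≤ ‖1 + E t‖ := fun t => by
    have := Complex.re_le_norm (1 + E t)
    simp only [Complex.add_re, Complex.one_re] at this
    linarith [hEpos t]
  have hnE : ∀ t, ‖E t‖ ≤ ‖1 + E t‖ := fun t => by
    refine le_of_sq_le_sq ?_ (norm_nonneg _)
    rw [← Complex.normSq_eq_norm_sq, ← Complex.normSq_eq_norm_sq, Complex.normSq_apply,
      Complex.normSq_apply]
    simp only [Complex.add_re, Complex.one_re, Complex.add_im, Complex.one_im]
    nlinarith [hEpos t]
  have hφn : ∀ t, ‖φ t‖ * ‖1 + E t‖ = 1 := fun t => by rw [← norm_mul, hφ1, norm_one]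
  refine ⟨φ * g, discAlgebra_mul_mem hφA hg, φ * E * g,
    discAlgebra_mul_mem (discAlgebra_mul_mem hφA hEA) hg, ?_, ?_, ?_⟩
  · ext t
    simp only [ContinuousMap.add_apply, ContinuousMap.mul_apply]
    linear_combination (-g t) * hφ1 t
  · rw [ContinuousMap.norm_le _ hM.le]
    intro t
    rw [ContinuousMap.mul_apply, norm_mul]
    calc ‖φ t‖ * ‖g t‖ ≤ ‖φ t‖ * (M * ‖1 + E t‖) := by
          gcongr; exact (hgE t).trans (by gcongr; exact hnE t)
      _ = M := by rw [mul_left_comm, hφn, mul_one]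
  · have h1 : ∫ t, ‖(φ * E * g) t‖ ^ 2 * ‖F t‖ ^ 2 ∂𝔪 ≤
        ∫ t, (M ^ 2 / 2 * ‖B t‖ ^ 2 + (2 * M ^ 2)⁻¹ * (‖g t‖ ^ 4 * ‖F t‖ ^ 2)) ∂𝔪 := by
      refine integral_haarAddCircle_mono (by fun_prop) (by fun_prop) fun t => ?_
      have h2 : ‖φ t‖ ≤ 1 := by nlinarith [hφn t, hn1 t, norm_nonneg (φ t)]
      simp only [ContinuousMap.mul_apply, norm_mul]
      rw [← hEF]
      calc (‖φ t‖ * ‖E t‖ * ‖g t‖) ^ 2 * ‖F t‖ ^ 2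
          ≤ (1 * ‖E t‖ * ‖g t‖) ^ 2 * ‖F t‖ ^ 2 := by gcongr
        _ = (‖E t‖ ^ 2 * ‖F t‖) * (‖g t‖ ^ 2 * ‖F t‖) := by ring
        _ ≤ _ := by
            have : M ^ 2 / 2 * (‖E t‖ ^ 2 * ‖F t‖) ^ 2 +
                (2 * M ^ 2)⁻¹ * (‖g t‖ ^ 4 * ‖F t‖ ^ 2) -
                (‖E t‖ ^ 2 * ‖F t‖) * (‖g t‖ ^ 2 * ‖F t‖) =
                (2 * M ^ 2)⁻¹ * (M ^ 2 * (‖E t‖ ^ 2 * ‖F t‖) - ‖g t‖ ^ 2 * ‖F t‖) ^ 2 := by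
              field_simp; ring
            have h5 : 0 ≤ (2 * M ^ 2)⁻¹ *
              (M ^ 2 * (‖E t‖ ^ 2 * ‖F t‖) - ‖g t‖ ^ 2 * ‖F t‖) ^ 2 := by positivity
            linarith
    rw [integral_add (Continuous.integrable_haarAddCircle (by fun_prop))
      (Continuous.integrable_haarAddCircle (by fun_prop)), integral_const_mul,
      integral_const_mul] at h1
    calc _ ≤ _ := h1
      _ ≤ M ^ 2 / 2 * (5 * Q / M ^ 4) + (2 * M ^ 2)⁻¹ * Q := by gcongr
      _ = 3 * Q / M ^ 2 := by field_simp; norm_num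

section Extension

variable {V : Type*} [NormedAddCommGroup V] [InnerProductSpace ℂ V]

/-- The operator `f ↦ ∑_{j < n} f̂(j) c_j`. -/
def coeffOp (c : ℕ → V) (n : ℕ) : C(𝕋, ℂ) →L[ℂ] V :=
  ∑ j ∈ Finset.range n, (coeffL (j : ℤ)).smulRight (c j)

lemma coeffOp_apply (c : ℕ → V) (n : ℕ) (f : C(𝕋, ℂ)) :
    coeffOp c n f = ∑ j ∈ Finset.range n, coeffL (j : ℤ) f • c j := by
  simp [coeffOp]

/-- The operator `f ↦ u (R P₊ (G f))` has a continuous density, where `u = coeffOp c n`. -/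
lemma exists_density_twisted_projection [CompleteSpace V] (c : ℕ → V) (n : ℕ) {R : C(𝕋, ℂ)}
    (hR : R ∈ discAlgebra) (G : C(𝕋, ℂ)) (hRG : ∀ t, R t * G t = 1) :
    ∃ Ψ : C(𝕋, V), ∀ m : ℤ, densityOp Ψ (R * fourier m) =
      if 0 ≤ m then coeffOp c n (R * fourier m) else 0 := by
  refine ⟨⟨fun t => ∑ j ∈ Finset.range n, ∑ i ∈ Finset.range n,
    (coeffL ((j : ℤ) - i) R * (G t * fourier (-(i : ℤ)) t)) • c j, by fun_prop⟩, fun m => ?_⟩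
  have h1 : densityOp (⟨fun t => ∑ j ∈ Finset.range n, ∑ i ∈ Finset.range n,
      (coeffL ((j : ℤ) - i) R * (G t * fourier (-(i : ℤ)) t)) • c j, by fun_prop⟩ : C(𝕋, V))
      (R * fourier m) = ∑ j ∈ Finset.range n, (∑ i ∈ Finset.range n,
        coeffL ((j : ℤ) - i) R * coeffL (i : ℤ) (fourier m)) • c j := by
    rw [densityOp_apply]
    have : ∀ t, (R * fourier m : C(𝕋, ℂ)) t • ((⟨fun t => ∑ j ∈ Finset.range n,
        ∑ i ∈ Finset.range n, (coeffL ((j : ℤ) - i) R * (G t * fourier (-(i : ℤ)) t)) • c j,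
        by fun_prop⟩ : C(𝕋, V)) t) = ∑ j ∈ Finset.range n, ∑ i ∈ Finset.range n,
          (coeffL ((j : ℤ) - i) R * (fourier m t * fourier (-(i : ℤ)) t)) • c j := by
      intro t
      simp only [ContinuousMap.mul_apply, ContinuousMap.coe_mk, Finset.smul_sum, smul_smul]
      refine Finset.sum_congr rfl fun j _ => Finset.sum_congr rfl fun i _ => ?_
      congr 1
      linear_combination (fourier m t * coeffL ((j : ℤ) - i) R * fourier (-(i : ℤ)) t) * hRG t
    simp_rw [this]
    rw [integral_finsetSum]
    · refine Finset.sum_congr rfl fun j _ => ?_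
      rw [integral_finsetSum, Finset.sum_smul]
      · refine Finset.sum_congr rfl fun i _ => ?_
        rw [integral_smul_const, integral_const_mul, coeffL_eq_meanL _ (fourier m), meanL_apply]
        rfl
      · exact fun i _ => Continuous.integrable_haarAddCircle (by fun_prop)
    · exact fun j _ => Continuous.integrable_haarAddCircle (by fun_prop)
  rw [h1]
  have h2 : ∀ j ∈ Finset.range n, (∑ i ∈ Finset.range n,
      coeffL ((j : ℤ) - i) R * coeffL (i : ℤ) (fourier m)) =
      if 0 ≤ m then coeffL ((j : ℤ) - m) R else 0 := by
    intro j hj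
    simp_rw [coeffL_fourier, mul_ite, mul_one, mul_zero]
    split_ifs with hm
    · obtain ⟨k, rfl⟩ := Int.eq_ofNat_of_zero_le hm
      simp only [Nat.cast_inj, Finset.sum_ite_eq', Finset.mem_range]
      split_ifs with hk
      · rfl
      · refine (mem_discAlgebra_iff.1 hR _ ?_).symm
        have := Finset.mem_range.1 hj
        omega
    · exact Finset.sum_eq_zero fun i _ => if_neg (by omega)
  rw [Finset.sum_congr rfl fun j hj => by rw [h2 j hj], coeffOp_apply]
  split_ifs with hm
  · refine Finset.sum_congr rfl fun j _ => ?_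
    rw [mul_comm R, coeffL_fourier_mul]
  · simp

/-- Changing the density improves the norm bound of an extension. -/
theorem exists_extension_improvement [FiniteDimensional ℂ V] (c : ℕ → V) (n : ℕ) {B γ : ℝ}
    (hγ : 0 < γ) (hB : ∀ f ∈ discAlgebra, ‖coeffOp c n f‖ ≤ B * ‖f‖) {Φ : C(𝕋, V)}
    (hΦ : ∀ f ∈ discAlgebra, densityOp Φ f = coeffOp c n f)
    (h : ∀ f, ‖densityOp Φ f‖ ≤ γ * ‖f‖) :
    ∃ Ψ : C(𝕋, V), (∀ f ∈ discAlgebra, densityOp Ψ f = coeffOp c n f) ∧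
      ∀ f, ‖densityOp Ψ f‖ ≤ (204 * B + γ / 2) * ‖f‖ := by
  have : CompleteSpace V := FiniteDimensional.complete ℂ V
  have hB0 : 0 ≤ B := by
    have := hB 1 one_mem_discAlgebra
    rw [norm_one, mul_one] at this
    exact (norm_nonneg _).trans this
  obtain ⟨D, hD0, hD1, hD2⟩ := exists_weight_norm_sq_le hγ h
  obtain ⟨t₀, -, ht₀⟩ := isCompact_univ.exists_isMinOn Set.univ_nonempty
    (by fun_prop : Continuous fun t => √(D t)).continuousOn
  have hmin : ∀ t, √(D t₀) ≤ √(D t) := fun t => ht₀ (Set.mem_univ t)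
  have hmin0 : 0 < √(D t₀) := Real.sqrt_pos.2 (hD0 t₀)
  obtain ⟨F, hF, hFw, hF2⟩ := exists_discAlgebra_re_near ⟨fun t => 3 / 2 * √(D t), by fun_prop⟩
    (half_pos hmin0)
  have hF1 : ∀ t, √(D t) ≤ (F t).re := fun t => by
    have := (abs_le.1 (hFw t)).1
    simp only [ContinuousMap.coe_mk] at this; linarith [hmin t]
  have hF3 : ∀ t, (F t).re ≤ 2 * √(D t) := fun t => by
    have := (abs_le.1 (hFw t)).2
    simp only [ContinuousMap.coe_mk] at this; linarith [hmin t]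
  have hpos : ∀ t, 0 < (F t).re := fun t => (Real.sqrt_pos.2 (hD0 t)).trans_le (hF1 t)
  have hFint : ∫ t, ‖F t‖ ^ 2 ∂𝔪 ≤ 24 * γ := by
    have h1 : ∫ t, (F t).re ^ 2 ∂𝔪 ≤ ∫ t, 4 * D t ∂𝔪 := by
      refine integral_haarAddCircle_mono (by fun_prop) (by fun_prop) fun t => ?_
      have h2 := pow_le_pow_left₀ (hpos t).le (hF3 t) 2
      rwa [mul_pow, Real.sq_sqrt (hD0 t).le, show (2 : ℝ) ^ 2 = 4 by norm_num] at h2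
    rw [integral_const_mul] at h1
    linarith
  have hDF : ∀ t, D t ≤ ‖F t‖ ^ 2 := fun t => by
    rw [← Real.sq_sqrt (hD0 t).le]
    exact pow_le_pow_left₀ (Real.sqrt_nonneg _) ((hF1 t).trans (Complex.re_le_norm _)) 2
  have hu2 : ∀ f ∈ discAlgebra, ‖coeffOp c n f‖ ^ 2 ≤ 3 * γ * ∫ t, ‖f t‖ ^ 2 * ‖F t‖ ^ 2 ∂𝔪 := by
    intro f hf
    rw [← hΦ f hf]
    refine (hD2 f).trans ?_
    refine mul_le_mul_of_nonneg_left ?_ (by positivity)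
    exact integral_haarAddCircle_mono (by fun_prop) (by fun_prop) fun t =>
      mul_le_mul_of_nonneg_left (hDF t) (by positivity)
  obtain ⟨G, hG, R, hR, hRG, hG2, -⟩ := exists_sqrt_mem_discAlgebra hF hpos
  have hRGm : ∀ f, R * (G * f) = f := fun f => by
    ext t
    simp only [ContinuousMap.mul_apply]
    rw [← mul_assoc, hRG, one_mul]
  have hRF : ∀ t, ‖R t‖ ^ 4 * ‖F t‖ ^ 2 = 1 := fun t => by
    have : ‖R t‖ * ‖G t‖ = 1 := by rw [← norm_mul, hRG, norm_one]
    rw [← hG2, norm_pow, ← pow_mul, ← mul_pow, this, one_pow]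
  obtain ⟨Ψ, hΨ⟩ := exists_density_twisted_projection c n hR G hRG
  set mulR : C(𝕋, ℂ) →L[ℂ] C(𝕋, ℂ) := ContinuousLinearMap.mul ℂ C(𝕋, ℂ) R with hmulR
  set L := (densityOp Ψ).comp mulR with hL
  set U := (coeffOp c n).comp mulR with hU
  have hLU : ∀ m : ℤ, L (fourier m) = if 0 ≤ m then U (fourier m) else 0 := hΨ
  refine ⟨Ψ, fun f hf => ?_, ?_⟩
  · have hker := discAlgebra_le_of_isClosed (S := (L - U).ker) (L - U).isClosed_ker
      (fun m => by simp [hLU]) (discAlgebra_mul_mem hG hf)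
    have h1 : L (G * f) = U (G * f) := by
      simpa [sub_eq_zero] using hker
    have h2 : densityOp Ψ (R * (G * f)) = coeffOp c n (R * (G * f)) := h1
    rwa [hRGm] at h2
  have hbound : ∀ p ∈ Submodule.span ℂ (Set.range (fourier (T := 2 * Real.pi))),
      ‖densityOp Ψ (R * p)‖ ≤ (204 * B + γ / 2) * ‖R * p‖ := by
    intro p hp
    obtain ⟨g, hg, k, hk, hk0, hpg, hLp⟩ := trigPolynomial_decomposition hLU hp
    change densityOp Ψ (R * p) = coeffOp c n (R * g) at hLp
    set N := ‖R * p‖ with hN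
    rcases (norm_nonneg (R * p)).eq_or_lt with h0 | h0
    · have : R * p = 0 := norm_eq_zero.1 h0.symm
      rw [hN, this]; simp
    rw [← hN] at h0
    have hg4 : ∫ t, ‖(R * g) t‖ ^ 4 * ‖F t‖ ^ 2 ∂𝔪 ≤ 1152 * γ * N ^ 4 := by
      have h1 : ∀ t, ‖(R * g) t‖ ^ 4 * ‖F t‖ ^ 2 = ‖g t‖ ^ 4 := fun t => by
        rw [ContinuousMap.mul_apply, norm_mul, mul_pow, mul_right_comm, hRF, one_mul]
      simp_rw [h1]
      refine (integral_pow_four_le hg hk hk0).trans ?_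
      rw [← hpg]
      have h2 : ∫ t, ‖p t‖ ^ 4 ∂𝔪 ≤ ∫ t, N ^ 4 * ‖F t‖ ^ 2 ∂𝔪 := by
        refine integral_haarAddCircle_mono (by fun_prop) (by fun_prop) fun t => ?_
        have h3 : ‖p t‖ ^ 4 = ‖(R * p) t‖ ^ 4 * ‖F t‖ ^ 2 := by
          rw [ContinuousMap.mul_apply, norm_mul, mul_pow, mul_right_comm, hRF, one_mul]
        rw [h3]
        have := ContinuousMap.norm_coe_le_norm (R * p) t
        gcongr
      rw [integral_const_mul] at h2
      nlinarith [mul_le_mul_of_nonneg_left hFint (pow_nonneg h0.le 4)]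
    obtain ⟨g₁, hg₁, g₂, hg₂, hg12, hn1, hn2⟩ := exists_truncation hF hpos
      (discAlgebra_mul_mem hR hg) (M := 204 * N) (Q := 1152 * γ * N ^ 4) (by positivity)
      (by positivity) hg4
    have hu1 : ‖coeffOp c n g₁‖ ≤ B * (204 * N) := (hB g₁ hg₁).trans (by gcongr)
    have hu3 : ‖coeffOp c n g₂‖ ≤ γ / 2 * N := by
      refine le_of_sq_le_sq ((hu2 g₂ hg₂).trans ?_) (by positivity)
      calc _ ≤ 3 * γ * (3 * (1152 * γ * N ^ 4) / (204 * N) ^ 2) := by gcongr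
        _ = 10368 / 41616 * (γ ^ 2 * N ^ 2) := by field_simp; ring
        _ ≤ 1 / 4 * (γ ^ 2 * N ^ 2) := by gcongr ?_ * _; norm_num
        _ = _ := by ring
    rw [hLp, hg12, map_add]
    refine (norm_add_le _ _).trans ?_
    linarith
  intro f
  have hclosed : IsClosed {p : C(𝕋, ℂ) | ‖densityOp Ψ (R * p)‖ ≤ (204 * B + γ / 2) * ‖R * p‖} :=
    isClosed_le (by fun_prop) (by fun_prop)
  have hcl : G * f ∈ closure (Submodule.span ℂ (Set.range (fourier (T := 2 * Real.pi))) :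
      Set C(𝕋, ℂ)) := by
    rw [← Submodule.topologicalClosure_coe, span_fourier_closure_eq_top]; trivial
  have hf : ‖densityOp Ψ (R * (G * f))‖ ≤ (204 * B + γ / 2) * ‖R * (G * f)‖ :=
    closure_minimal hbound hclosed hcl
  rwa [hRGm] at hf

end Extension

section UniformExtension

variable {V : Type*} [NormedAddCommGroup V] [InnerProductSpace ℂ V]

lemma exists_density_coeffOp [CompleteSpace V] (c : ℕ → V) (n : ℕ) :
    ∃ Φ : C(𝕋, V), densityOp Φ = coeffOp c n := by
  refine ⟨⟨fun t => ∑ j ∈ Finset.range n, (fourier (-(j : ℤ)) t : ℂ) • c j, by fun_prop⟩, ?_⟩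
  ext f
  rw [densityOp_apply, coeffOp_apply]
  simp only [ContinuousMap.coe_mk, Finset.smul_sum, smul_smul]
  rw [integral_finsetSum]
  · refine Finset.sum_congr rfl fun j _ => ?_
    rw [integral_smul_const, coeffL_eq_meanL, meanL_apply]
    rfl
  · exact fun i _ => Continuous.integrable_haarAddCircle (by fun_prop)

/-- A finite-rank spectral operator bounded on the disc algebra extends to `C(𝕋, ℂ)` with control
of the norm by an absolute constant. -/
theorem exists_extension_coeffOp [FiniteDimensional ℂ V] (c : ℕ → V) (n : ℕ) {B : ℝ}
    (hB0 : 0 < B) (hB : ∀ f ∈ discAlgebra, ‖coeffOp c n f‖ ≤ B * ‖f‖) :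
    ∃ w : C(𝕋, ℂ) →L[ℂ] V, (∀ f ∈ discAlgebra, w f = coeffOp c n f) ∧
      ∀ f, ‖w f‖ ≤ 409 * B * ‖f‖ := by
  have : CompleteSpace V := FiniteDimensional.complete ℂ V
  obtain ⟨Φ₀, hΦ₀⟩ := exists_density_coeffOp c n
  set γ := ‖coeffOp c n‖ with hγ
  have hγ0 : 0 ≤ γ := norm_nonneg _
  have key : ∀ k : ℕ, ∃ Φ : C(𝕋, V), (∀ f ∈ discAlgebra, densityOp Φ f = coeffOp c n f) ∧
      ∀ f, ‖densityOp Φ f‖ ≤ (408 * B + γ * (1 / 2) ^ k) * ‖f‖ := by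
    intro k
    induction k with
    | zero =>
      refine ⟨Φ₀, fun f _ => by rw [hΦ₀], fun f => ?_⟩
      rw [hΦ₀, pow_zero, mul_one]
      exact ((coeffOp c n).le_opNorm f).trans (by gcongr; linarith)
    | succ k ih =>
      obtain ⟨Φ, hΦ, h⟩ := ih
      obtain ⟨Ψ, hΨ, h'⟩ := exists_extension_improvement c n (by positivity) hB hΦ h
      refine ⟨Ψ, hΨ, fun f => (h' f).trans_eq ?_⟩
      ring
  obtain ⟨k, hk⟩ := exists_pow_lt_of_lt_one (div_pos hB0 (by positivity : 0 < γ + 1))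
    (by norm_num : (1 / 2 : ℝ) < 1)
  obtain ⟨Φ, hΦ, h⟩ := key k
  refine ⟨densityOp Φ, hΦ, fun f => (h f).trans ?_⟩
  rw [lt_div_iff₀ (by positivity)] at hk
  have : 0 ≤ (1 / 2 : ℝ) ^ k := by positivity
  gcongr
  nlinarith

lemma fejer_mem_discAlgebra (n : ℕ) {f : C(𝕋, ℂ)} (hf : f ∈ discAlgebra) :
    fejer n f ∈ discAlgebra :=
  analyticPolynomials_le_discAlgebra (fejer_mem_analyticPolynomials n hf)

/-- An operator on the disc algebra composed with a Fejér mean is a finite spectral sum. -/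
lemma exists_coeffOp_eq_comp_fejer (T : discAlgebra →L[ℂ] V) (n : ℕ) :
    ∃ c : ℕ → V, ∀ f (hf : f ∈ discAlgebra),
      coeffOp c n f = T ⟨fejer n f, fejer_mem_discAlgebra n hf⟩ := by
  let e : ℕ → discAlgebra := fun j => ⟨fourier (j : ℤ), fourier_mem_discAlgebra j⟩
  refine ⟨fun j => (n : ℂ)⁻¹ • ∑ k ∈ Finset.range n, ∑ l ∈ Finset.range n,
    if (k : ℤ) - l = j then T (e j) else 0, fun f hf => ?_⟩
  have hdiag : ∀ {W : Type _} [AddCommGroup W] [Module ℂ W] (x : ℤ → W),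
      ∀ k ∈ Finset.range n, ∀ l ∈ Finset.range n,
      coeffL ((k : ℤ) - l) f • x ((k : ℤ) - l) =
        ∑ j ∈ Finset.range n, if (k : ℤ) - l = j then coeffL (j : ℤ) f • x j else 0 := by
    intro W _ _ x k hk l _
    have hk' := Finset.mem_range.1 hk
    rcases lt_or_ge ((k : ℤ) - l) 0 with h | h
    · rw [mem_discAlgebra_iff.1 hf _ h, zero_smul]
      exact (Finset.sum_eq_zero fun j _ => if_neg (by omega)).symm
    · obtain ⟨j, hj⟩ := Int.eq_ofNat_of_zero_le h
      rw [hj]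
      simp only [Nat.cast_inj, Finset.sum_ite_eq, Finset.mem_range]
      rw [if_pos (by omega)]
  have hfejer : (⟨fejer n f, fejer_mem_discAlgebra n hf⟩ : discAlgebra) =
      (n : ℂ)⁻¹ • ∑ k ∈ Finset.range n, ∑ l ∈ Finset.range n, ∑ j ∈ Finset.range n,
        if (k : ℤ) - l = j then coeffL (j : ℤ) f • e j else 0 := by
    apply Subtype.ext
    simp only [fejer_apply, Submodule.coe_smul, Submodule.coe_sum]
    congr 1
    refine Finset.sum_congr rfl fun k hk => Finset.sum_congr rfl fun l hl => ?_
    rw [hdiag (fun m => (fourier m : C(𝕋, ℂ))) k hk l hl]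
    refine Finset.sum_congr rfl fun j _ => ?_
    split_ifs <;> rfl
  rw [hfejer, coeffOp_apply, map_smul, map_sum]
  simp only [map_sum, smul_comm _ (n : ℂ)⁻¹]
  rw [← Finset.smul_sum]
  congr 1
  simp only [Finset.smul_sum]
  rw [Finset.sum_comm]
  refine Finset.sum_congr rfl fun k _ => ?_
  rw [Finset.sum_comm]
  refine Finset.sum_congr rfl fun l _ => Finset.sum_congr rfl fun j _ => ?_
  split_ifs <;> simp

end UniformExtension

/-- The projection of `ℓ₂` onto its first `n` coordinates. -/
def lpTruncation (n : ℕ) : lp (fun _ : ℕ => ℂ) 2 →L[ℂ] EuclideanSpace ℂ (Fin n) :=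
  LinearMap.mkContinuous
    { toFun := fun x => WithLp.toLp 2 fun i => x i
      map_add' := fun _ _ => rfl
      map_smul' := fun _ _ => rfl } 1
    (fun x => by
      rw [one_mul]
      refine le_of_sq_le_sq ?_ (norm_nonneg _)
      have h := lp.sum_rpow_le_norm_rpow (p := 2) (by norm_num) x (Finset.range n)
      rw [EuclideanSpace.norm_sq_eq]
      change ∑ i : Fin n, ‖x i‖ ^ 2 ≤ _
      rw [Fin.sum_univ_eq_sum_range fun i => ‖x i‖ ^ 2]
      simpa using h)

lemma lpTruncation_apply (n : ℕ) (x : lp (fun _ : ℕ => ℂ) 2) (i : Fin n) :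
    lpTruncation n x i = x i := rfl

lemma norm_lpTruncation_le (n : ℕ) : ‖lpTruncation n‖ ≤ 1 :=
  LinearMap.mkContinuous_norm_le _ zero_le_one _

/-- A sequence of uniformly bounded operators into coordinate spaces has a coordinatewise limit
point among the operators into `ℓ₂`. -/
lemma exists_ultralimit {X : Type*} [NormedAddCommGroup X] [NormedSpace ℂ X]
    (w : ∀ n : ℕ, X →L[ℂ] EuclideanSpace ℂ (Fin n)) {C : ℝ} (hC : 0 ≤ C)
    (hw : ∀ n f, ‖w n f‖ ≤ C * ‖f‖) :
    ∃ v : X →L[ℂ] lp (fun _ : ℕ => ℂ) 2, ‖v‖ ≤ C ∧ ∀ f (x : lp (fun _ : ℕ => ℂ) 2),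
      (∀ i : ℕ, Tendsto (fun n => if h : i < n then w n f ⟨i, h⟩ else 0) atTop (𝓝 (x i))) →
        v f = x := by
  let W : ℕ → X → ℕ → ℂ := fun n f i => if h : i < n then w n f ⟨i, h⟩ else 0
  have hWsum : ∀ n f (s : Finset ℕ), ∑ i ∈ s, ‖W n f i‖ ^ 2 ≤ (C * ‖f‖) ^ 2 := by
    intro n f s
    have h1 : ∑ i ∈ s, ‖W n f i‖ ^ 2 = ∑ i ∈ s.filter (· < n), ‖W n f i‖ ^ 2 := by
      refine (Finset.sum_filter_of_ne fun i _ hi => ?_).symm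
      by_contra h
      simp [W, h] at hi
    have h2 : ∑ i ∈ Finset.range n, ‖W n f i‖ ^ 2 = ‖w n f‖ ^ 2 := by
      rw [EuclideanSpace.norm_sq_eq, Finset.sum_fin_eq_sum_range]
      refine Finset.sum_congr rfl fun i hi => ?_
      simp [W, Finset.mem_range.1 hi]
    rw [h1]
    refine (Finset.sum_le_sum_of_subset_of_nonneg (t := Finset.range n) (fun i hi => ?_)
      fun _ _ _ => by positivity).trans ?_
    · exact Finset.mem_range.2 (Finset.mem_filter.1 hi).2
    · rw [h2]
      exact pow_le_pow_left₀ (norm_nonneg _) (hw n f) 2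
  have hlim : ∀ f i, ∃ z, Tendsto (fun n => W n f i) (hyperfilter ℕ : Filter ℕ) (𝓝 z) := by
    intro f i
    obtain ⟨z, -, hz⟩ := (isCompact_closedBall (0 : ℂ) (C * ‖f‖)).ultrafilter_le_nhds'
      ((hyperfilter ℕ).map fun n => W n f i) (by
        refine Filter.mem_map.2 (Filter.univ_mem' fun n => ?_)
        have := hWsum n f {i}
        rw [Finset.sum_singleton] at this
        exact mem_closedBall_zero_iff.2 (le_of_sq_le_sq this (by positivity)))
    exact ⟨z, hz⟩
  choose z hz using hlim
  have hzsum : ∀ f (s : Finset ℕ), ∑ i ∈ s, ‖z f i‖ ^ 2 ≤ (C * ‖f‖) ^ 2 := fun f s =>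
    le_of_tendsto (tendsto_finsetSum s fun i _ => ((hz f i).norm.pow 2))
      (Eventually.of_forall fun n => hWsum n f s)
  have hmem : ∀ f, Memℓp (z f) 2 := fun f =>
    memℓp_gen' (C := (C * ‖f‖) ^ 2) fun s => by simpa using hzsum f s
  let v : X →L[ℂ] lp (fun _ : ℕ => ℂ) 2 := LinearMap.mkContinuous
    { toFun := fun f => ⟨z f, hmem f⟩
      map_add' := fun f g => by
        ext i
        refine tendsto_nhds_unique (hz (f + g) i) (((hz f i).add (hz g i)).congr fun n => ?_)
        simp only [W]
        split_ifs <;> simp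
      map_smul' := fun a f => by
        ext i
        refine tendsto_nhds_unique (hz (a • f) i) (((hz f i).const_smul a).congr fun n => ?_)
        simp only [W]
        split_ifs <;> simp } C
    (fun f => lp.norm_le_of_forall_sum_le (by norm_num) (by positivity) fun s => by
      simpa using hzsum f s)
  refine ⟨v, LinearMap.mkContinuous_norm_le _ hC _, fun f x hx => ?_⟩
  ext i
  exact tendsto_nhds_unique (hz f i) ((hx i).mono_left Nat.hyperfilter_le_atTop)

/-- **Bourgain's theorem (extension form)**: there is an absolute constant `K` such that every
bounded linear operator `u` from the disc algebra into `ℓ₂` extends to a bounded linear operator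
`û : C(𝕋, ℂ) → ℓ₂` with `û` agreeing with `u` on the disc algebra and `‖û‖ ≤ K‖u‖`. -/
theorem bourgain_disc_algebra_extension :
    ∃ K : ℝ, 0 < K ∧
      ∀ u : discAlgebra →L[ℂ] lp (fun _ : ℕ => ℂ) 2,
        ∃ uhat : C(𝕋, ℂ) →L[ℂ] lp (fun _ : ℕ => ℂ) 2,
          (∀ f : discAlgebra, uhat (f : C(𝕋, ℂ)) = u f) ∧ ‖uhat‖ ≤ K * ‖u‖ := by
  refine ⟨409, by norm_num, fun u => ?_⟩
  rcases (norm_nonneg u).eq_or_lt with hu | hu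
  · refine ⟨0, fun f => (norm_le_zero_iff.1 ((u.le_opNorm f).trans ?_)).symm, ?_⟩
    · rw [← hu, zero_mul]
    · rw [← hu, mul_zero]
      exact ContinuousLinearMap.opNorm_le_bound _ le_rfl fun f => by simp
  have hw : ∀ n, ∃ w : C(𝕋, ℂ) →L[ℂ] EuclideanSpace ℂ (Fin n),
      (∀ f (hf : f ∈ discAlgebra),
        w f = lpTruncation n (u ⟨fejer n f, fejer_mem_discAlgebra n hf⟩)) ∧
      ∀ f, ‖w f‖ ≤ 409 * ‖u‖ * ‖f‖ := by
    intro n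
    obtain ⟨c, hc⟩ := exists_coeffOp_eq_comp_fejer ((lpTruncation n).comp u) n
    obtain ⟨w, hw, hwn⟩ := exists_extension_coeffOp c n hu fun f hf => by
      rw [hc f hf]
      calc _ ≤ ‖lpTruncation n‖ * ‖u ⟨fejer n f, _⟩‖ := (lpTruncation n).le_opNorm _
        _ ≤ 1 * (‖u‖ * ‖fejer n f‖) :=
            mul_le_mul (norm_lpTruncation_le n) (u.le_opNorm _) (norm_nonneg _) zero_le_one
        _ ≤ ‖u‖ * ‖f‖ := by rw [one_mul]; gcongr; exact norm_fejer_apply_le n f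
    exact ⟨w, fun f hf => (hw f hf).trans (hc f hf), hwn⟩
  choose w hwA hwn using hw
  obtain ⟨v, hvn, hv⟩ := exists_ultralimit w (by positivity) hwn
  refine ⟨v, fun f => hv f (u f) fun i => ?_, hvn⟩
  have h1 : Tendsto (fun n => u ⟨fejer n f, fejer_mem_discAlgebra n f.2⟩) atTop (𝓝 (u f)) :=
    (u.continuous.tendsto f).comp (tendsto_subtype_rng.2 (tendsto_fejer f))
  have h2 : Tendsto (fun n => u ⟨fejer n f, fejer_mem_discAlgebra n f.2⟩ i) atTop
      (𝓝 (u f i)) := by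
    rw [tendsto_iff_norm_sub_tendsto_zero] at h1 ⊢
    exact squeeze_zero (fun _ => norm_nonneg _)
      (fun n => lp.norm_apply_le_norm two_ne_zero
        (u ⟨fejer n f, fejer_mem_discAlgebra n f.2⟩ - u f) i) h1
  refine h2.congr' ?_
  filter_upwards [eventually_gt_atTop i] with n hn
  rw [dif_pos hn, hwA n f f.2, lpTruncation_apply]
end
end

section
/- There is an absolute constant C such that for every t > 0 and every sequence f = (f_k) of functions on 𝕋 admitting a decomposition f = a + b with a ∈ H¹(ℓ₁) and b ∈ H¹(ℓ₂), one has K_t(f; H¹(ℓ₁), H¹(ℓ₂)) ≤ C·K_t(f; L¹(ℓ₁), L¹(ℓ₂)), where the K-functionals are taken over decompositions of f into analytic, respectively arbitrary, summands. -/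
open MeasureTheory Real ENNReal NNReal

noncomputable section

/-- The normalized Haar measure on `𝕋`. -/
abbrev μ𝕋 : Measure 𝕋 := AddCircle.haarAddCircle

/-- The mixed norm `‖f‖_{L^p(ℓ_q)} = (∫ (∑_k |f_k|^q)^{p/q} dm)^{1/p}` of a sequence
`f = (f_k)` of functions on `𝕋`, valued in `ℝ≥0∞`. -/
def eLpLqNorm (p q : ℝ) (f : ℕ → 𝕋 → ℂ) : ℝ≥0∞ :=
  (∫⁻ t, ((∑' k, (‖f k t‖₊ : ℝ≥0∞) ^ q) ^ (1 / q)) ^ p ∂μ𝕋) ^ (1 / p)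

/-- `f = (f_k)` belongs to `L^p(ℓ_q)`. -/
def MemLpLq (p q : ℝ) (f : ℕ → 𝕋 → ℂ) : Prop :=
  (∀ k, AEStronglyMeasurable (f k) μ𝕋) ∧ eLpLqNorm p q f < ⊤

/-- `f = (f_k)` belongs to `H^p(ℓ_q)`: it belongs to `L^p(ℓ_q)` and every Fourier
coefficient `f̂_k(n)` with `n < 0` vanishes. -/
def MemHpLq (p q : ℝ) (f : ℕ → 𝕋 → ℂ) : Prop :=
  MemLpLq p q f ∧ ∀ k, ∀ n : ℤ, n < 0 → fourierCoeff (f k) n = 0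

/-- The K-functional `K_t(f; X₀, X₁)` for a couple of spaces of sequences of functions given
by membership predicates `X₀, X₁` and (quasi-)norms `N₀, N₁`:
`inf {N₀(g₀) + t N₁(g₁) : f = g₀ + g₁, g₀ ∈ X₀, g₁ ∈ X₁}`. -/
def Kfunctional (t : ℝ≥0∞) (X₀ X₁ : (ℕ → 𝕋 → ℂ) → Prop)
    (N₀ N₁ : (ℕ → 𝕋 → ℂ) → ℝ≥0∞) (f : ℕ → 𝕋 → ℂ) : ℝ≥0∞ :=
  ⨅ (g₀ : ℕ → 𝕋 → ℂ) (g₁ : ℕ → 𝕋 → ℂ) (_ : X₀ g₀) (_ : X₁ g₁) (_ : f = g₀ + g₁),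
    N₀ g₀ + t * N₁ g₁


theorem Complex.sq_sqrt (z : ℂ) : z.sqrt ^ 2 = z := by
  simp [Complex.sqrt]

theorem Complex.sqrt_ne_zero_of_re_pos {z : ℂ} (hz : 0 < z.re) : z.sqrt ≠ 0 := by
  intro h0
  have := Complex.sq_sqrt z
  rw [h0] at this
  simp [← this] at hz

theorem Complex.norm_sqrt_sq (z : ℂ) : ‖z.sqrt‖ ^ 2 = ‖z‖ := by
  rw [← norm_pow, Complex.sq_sqrt]

theorem Complex.abs_im_sqrt_le_re_sqrt {z : ℂ} (hz : 0 ≤ z.re) :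
    |z.sqrt.im| ≤ z.sqrt.re := by
  have h0 : 0 ≤ z.sqrt.re := by
    rw [Complex.sqrt, Complex.cpow_inv_two_re]
    positivity
  refine abs_le_of_sq_le_sq ?_ h0
  have h := congrArg Complex.re (Complex.sq_sqrt z)
  simp only [pow_two, Complex.mul_re] at h
  nlinarith

theorem Complex.re_sqrt_div_sqrt_nonneg {z w : ℂ} (hz : 0 ≤ z.re) (hw : 0 ≤ w.re) :
    0 ≤ (z.sqrt / w.sqrt).re := by
  have h1 := Complex.abs_im_sqrt_le_re_sqrt hz
  have h2 := Complex.abs_im_sqrt_le_re_sqrt hw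
  rw [Complex.div_re, ← add_div]
  refine div_nonneg ?_ (Complex.normSq_nonneg _)
  rw [abs_le] at h1 h2
  nlinarith

/-- A function of two variables in the right half-plane which is bounded, holomorphic, small where
`‖w‖` is small compared with `‖z‖`, and close to `1` where `‖z‖` is small compared with `‖w‖`. -/
noncomputable def halfPlaneCutoff (z w : ℂ) : ℂ := (1 + z.sqrt / w.sqrt)⁻¹ ^ 4

theorem Complex.one_le_norm_one_add {v : ℂ} (hv : 0 ≤ v.re) : 1 ≤ ‖1 + v‖ := by
  have := Complex.re_le_norm (1 + v)
  simp only [Complex.add_re, Complex.one_re] at this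
  linarith

theorem Complex.norm_le_norm_one_add {v : ℂ} (hv : 0 ≤ v.re) : ‖v‖ ≤ ‖1 + v‖ := by
  refine le_of_sq_le_sq ?_ (norm_nonneg _)
  rw [Complex.sq_norm, Complex.sq_norm, Complex.normSq_apply, Complex.normSq_apply]
  simp only [Complex.add_re, Complex.one_re, Complex.add_im, Complex.one_im]
  nlinarith

theorem norm_halfPlaneCutoff_le_one {z w : ℂ} (hz : 0 ≤ z.re) (hw : 0 ≤ w.re) :
    ‖halfPlaneCutoff z w‖ ≤ 1 := by
  have h := Complex.one_le_norm_one_add (Complex.re_sqrt_div_sqrt_nonneg hz hw)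
  rw [halfPlaneCutoff, norm_pow, norm_inv]
  exact pow_le_one₀ (by positivity) (inv_le_one_of_one_le₀ h)

theorem norm_sq_mul_norm_halfPlaneCutoff_le {z w : ℂ} (hz : 0 ≤ z.re) (hw : 0 < w.re) :
    ‖z‖ ^ 2 * ‖halfPlaneCutoff z w‖ ≤ ‖w‖ ^ 2 := by
  have hv := Complex.re_sqrt_div_sqrt_nonneg hz hw.le
  have h1 := Complex.one_le_norm_one_add hv
  have h := Complex.norm_le_norm_one_add hv
  have hw0 : 0 < ‖w.sqrt‖ := norm_pos_iff.mpr (Complex.sqrt_ne_zero_of_re_pos hw)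
  rw [norm_div, div_le_iff₀ hw0] at h
  rw [halfPlaneCutoff, norm_pow, norm_inv, ← Complex.norm_sqrt_sq z, ← Complex.norm_sqrt_sq w,
    inv_pow, ← div_eq_mul_inv, div_le_iff₀ (by positivity), ← pow_mul, ← pow_mul, ← mul_pow,
    mul_comm]
  exact pow_le_pow_left₀ (norm_nonneg _) (by linarith) _

theorem norm_one_sub_halfPlaneCutoff_sq_mul_le {z w : ℂ} (hz : 0 ≤ z.re) (hw : 0 < w.re) :
    ‖1 - halfPlaneCutoff z w‖ ^ 2 * ‖w‖ ≤ 16 * ‖z‖ := by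
  have hv := Complex.re_sqrt_div_sqrt_nonneg hz hw.le
  have h1 := Complex.one_le_norm_one_add hv
  have hw0 := Complex.sqrt_ne_zero_of_re_pos hw
  have hkey : ‖1 - halfPlaneCutoff z w‖ ≤ 4 * ‖z.sqrt / w.sqrt‖ := by
    rw [halfPlaneCutoff]
    set v := z.sqrt / w.sqrt
    have hne : 1 + v ≠ 0 := norm_pos_iff.mp (by linarith)
    set p := (1 + v)⁻¹ with hp
    have hp1 : ‖p‖ ≤ 1 := by
      rw [hp, norm_inv]
      exact inv_le_one_of_one_le₀ h1
    have e : 1 - p ^ 4 = (1 + p + p ^ 2 + p ^ 3) * p * v := by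
      have : p * (1 + v) = 1 := inv_mul_cancel₀ hne
      linear_combination (-(1 + p + p ^ 2 + p ^ 3)) * this
    rw [e, norm_mul]
    gcongr
    rw [norm_mul]
    have : ‖1 + p + p ^ 2 + p ^ 3‖ ≤ 4 := by
      have h2 : ‖p ^ 2‖ ≤ 1 := by rw [norm_pow]; exact pow_le_one₀ (norm_nonneg _) hp1
      have h3 : ‖p ^ 3‖ ≤ 1 := by rw [norm_pow]; exact pow_le_one₀ (norm_nonneg _) hp1
      have := norm_add₄_le (a := (1 : ℂ)) (b := p) (c := p ^ 2) (d := p ^ 3)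
      rw [norm_one] at this
      linarith
    nlinarith [norm_nonneg p, norm_nonneg (1 + p + p ^ 2 + p ^ 3)]
  calc ‖1 - halfPlaneCutoff z w‖ ^ 2 * ‖w‖ ≤ (4 * ‖z.sqrt / w.sqrt‖) ^ 2 * ‖w‖ := by gcongr
    _ = 16 * ‖z‖ := by
      rw [← Complex.norm_sqrt_sq z, ← Complex.norm_sqrt_sq w, norm_div]
      have := norm_ne_zero_iff.mpr hw0
      field_simp
      ring

theorem continuousAt_halfPlaneCutoff {z w : ℂ} (hz : 0 ≤ z.re) (hw : 0 < w.re) :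
    ContinuousAt (fun p : ℂ × ℂ => halfPlaneCutoff p.1 p.2) (z, w) := by
  have h1 : ContinuousAt (fun p : ℂ × ℂ => p.1.sqrt) (z, w) :=
    ContinuousAt.comp (f := Prod.fst) (g := Complex.sqrt)
      (Complex.continuousAt_sqrt (Or.inl hz)) continuousAt_fst
  have h2 : ContinuousAt (fun p : ℂ × ℂ => p.2.sqrt) (z, w) :=
    ContinuousAt.comp (f := Prod.snd) (g := Complex.sqrt)
      (Complex.continuousAt_sqrt (Or.inl hw.le)) continuousAt_snd
  have hv := Complex.one_le_norm_one_add (Complex.re_sqrt_div_sqrt_nonneg hz hw.le)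
  have hw0 := Complex.sqrt_ne_zero_of_re_pos hw
  have hv0 : 1 + z.sqrt / w.sqrt ≠ 0 := norm_pos_iff.mp (by linarith)
  exact ((continuousAt_const.add (h1.div h2 hw0)).inv₀ hv0).pow 4

theorem DifferentiableOn.halfPlaneCutoff {F G : ℂ → ℂ} {s : Set ℂ} (hF : DifferentiableOn ℂ F s)
    (hG : DifferentiableOn ℂ G s) (hF' : ∀ z ∈ s, 0 < (F z).re) (hG' : ∀ z ∈ s, 0 < (G z).re) :
    DifferentiableOn ℂ (fun z => halfPlaneCutoff (F z) (G z)) s := by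
  intro z hz
  have h1 := (Complex.differentiableAt_sqrt (Or.inl (hF' z hz))).comp_differentiableWithinAt z
    (hF z hz)
  have h2 := (Complex.differentiableAt_sqrt (Or.inl (hG' z hz))).comp_differentiableWithinAt z
    (hG z hz)
  have hv := Complex.one_le_norm_one_add
    (Complex.re_sqrt_div_sqrt_nonneg (hF' z hz).le (hG' z hz).le)
  have hw0 := Complex.sqrt_ne_zero_of_re_pos (hG' z hz)
  have hv0 : 1 + (F z).sqrt / (G z).sqrt ≠ 0 := norm_pos_iff.mp (by linarith)
  exact ((h1.div h2 hw0).const_add 1 |>.inv hv0).pow 4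

open AddCircle Filter Topology in
theorem fourier_natCast {T : ℝ} (j : ℕ) (x : AddCircle T) :
    fourier (j : ℤ) x = fourier 1 x ^ j := by
  induction j with
  | zero => simp
  | succ j ih => rw [Nat.cast_succ, fourier_add, ih, pow_succ]

section Fourier
open AddCircle Filter Topology

variable {T : ℝ} [hT : Fact (0 < T)]

omit hT in
theorem norm_fourier_apply (n : ℤ) (x : AddCircle T) : ‖fourier n x‖ = 1 := by
  rw [fourier_apply, Circle.norm_coe]

theorem hasSum_fourierCoeff_mul {c : ℕ → ℂ} (hc : Summable fun j => ‖c j‖)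
    {f : AddCircle T → ℂ} (hf : Integrable f haarAddCircle) {F : AddCircle T → ℂ}
    (hF : ∀ x, HasSum (fun j : ℕ => c j * fourier 1 x ^ j) (F x)) (n : ℤ) :
    HasSum (fun j : ℕ => c j * fourierCoeff f (n - j)) (fourierCoeff (fun x => F x * f x) n) := by
  have hint (j : ℕ) : Integrable (fun x => c j * (fourier (-(n - j)) x • f x)) haarAddCircle :=
    (hf.fourier_smul _).const_mul _
  have hnorm (j : ℕ) : ∫ x, ‖c j * (fourier (-(n - j)) x • f x)‖ ∂haarAddCircle
      = ‖c j‖ * ∫ x, ‖f x‖ ∂haarAddCircle := by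
    rw [← integral_const_mul]
    congr with x
    rw [norm_mul, norm_smul, norm_fourier_apply, one_mul]
  have h := hasSum_integral_of_summable_integral_norm hint
    (by simp_rw [hnorm]; exact hc.mul_right _)
  have hcoeff (j : ℕ) : ∫ x, c j * (fourier (-(n - j)) x • f x) ∂haarAddCircle
      = c j * fourierCoeff f (n - j) := integral_const_mul _ _
  simp_rw [hcoeff] at h
  rw [fourierCoeff, integral_congr_ae (ae_of_all _ fun x => ?_)]
  · exact h
  have h2 := ((hF x).mul_right (f x)).mul_left (fourier (-n) x)
  rw [smul_eq_mul, ← h2.tsum_eq]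
  refine tsum_congr fun j => ?_
  rw [neg_sub, sub_eq_neg_add, fourier_add, fourier_natCast, smul_eq_mul]
  ring

theorem fourierCoeff_mul_eq_zero_of_differentiableOn {F : ℂ → ℂ} {R : ℝ} (hR : 1 < R)
    (hF : DifferentiableOn ℂ F (Metric.ball 0 R)) {f : AddCircle T → ℂ}
    (hf : Integrable f haarAddCircle) (hf0 : ∀ n : ℤ, n < 0 → fourierCoeff f n = 0)
    {n : ℤ} (hn : n < 0) : fourierCoeff (fun x => F (fourier 1 x) * f x) n = 0 := by
  have hs (z : ℂ) (hz : ‖z‖ < R) :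
      HasSum (fun j : ℕ => ((j.factorial : ℂ)⁻¹ * iteratedDeriv j F 0) * z ^ j) (F z) := by
    have := Complex.hasSum_taylorSeries_on_ball hF (z := z) (by simpa using hz)
    simp only [sub_zero, smul_eq_mul, ← mul_assoc] at this
    simpa only [mul_right_comm] using this
  have hc : Summable fun j : ℕ => ‖(j.factorial : ℂ)⁻¹ * iteratedDeriv j F 0‖ := by
    have := (hs 1 (by simpa using hR)).summable.norm
    simpa only [one_pow, mul_one] using this
  have h := hasSum_fourierCoeff_mul hc hf
    (fun x => hs (fourier 1 x) (by rwa [norm_fourier_apply])) n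
  have h0 (j : ℕ) : fourierCoeff f (n - j) = 0 := hf0 _ (by lia)
  simp only [h0, mul_zero] at h
  exact h.unique hasSum_zero

theorem hasSum_sq_fourierCoeff_of_memLp {f : AddCircle T → ℂ} (hf : MemLp f 2 haarAddCircle) :
    HasSum (fun i => ‖fourierCoeff f i‖ ^ 2) (∫ t, ‖f t‖ ^ 2 ∂haarAddCircle) := by
  convert hasSum_sq_fourierCoeff hf.toLp using 1
  · simp_rw [fourierCoeff_congr_ae hf.coeFn_toLp]
  · refine integral_congr_ae ?_
    filter_upwards [hf.coeFn_toLp] with x hx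
    rw [hx]

theorem lintegral_enorm_sq_eq_ofReal_tsum {f : AddCircle T → ℂ} (hf : MemLp f 2 haarAddCircle) :
    ∫⁻ t, ‖f t‖ₑ ^ 2 ∂haarAddCircle = ENNReal.ofReal (∑' i, ‖fourierCoeff f i‖ ^ 2) := by
  rw [(hasSum_sq_fourierCoeff_of_memLp hf).tsum_eq,
    ofReal_integral_eq_lintegral_ofReal hf.norm.integrable_sq
      (ae_of_all _ fun _ => by positivity)]
  simp_rw [ENNReal.ofReal_pow (norm_nonneg _), ofReal_norm]

theorem ae_eq_zero_of_fourierCoeff_eq_zero {f : AddCircle T → ℂ} (hf : MemLp f 2 haarAddCircle)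
    (h : ∀ n, fourierCoeff f n = 0) : f =ᵐ[haarAddCircle] 0 := by
  have h2 := lintegral_enorm_sq_eq_ofReal_tsum hf
  simp only [h, norm_zero, ne_eq, OfNat.ofNat_ne_zero, not_false_eq_true, zero_pow, tsum_zero,
    ENNReal.ofReal_zero] at h2
  rw [lintegral_eq_zero_iff' (hf.1.enorm.pow_const 2)] at h2
  filter_upwards [h2] with x hx
  simpa using hx

theorem fourierCoeff_star (f : AddCircle T → ℂ) (n : ℤ) :
    fourierCoeff (fun x => (starRingEnd ℂ) (f x)) n
      = (starRingEnd ℂ) (fourierCoeff f (-n)) := by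
  rw [fourierCoeff, fourierCoeff, ← integral_conj]
  congr with x
  rw [smul_eq_mul, smul_eq_mul, map_mul, ← fourier_neg, neg_neg]

theorem fourierCoeff_one (n : ℤ) :
    fourierCoeff (fun _ : AddCircle T => (1 : ℂ)) n = if n = 0 then 1 else 0 := by
  have h := fourierCoeff_fourier (T := T) 0
  have h2 : (fun _ : AddCircle T => (1 : ℂ)) = fourier 0 := by ext; simp
  rw [h2, h]
  by_cases hn : n = 0
  · subst hn; simp
  · simp [hn]

end Fourier

section Completion
open AddCircle Filter Topology

variable {T : ℝ} [hT : Fact (0 < T)]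

theorem hasSum_one_add_div_one_sub {w : ℂ} (hw : ‖w‖ < 1) :
    HasSum (fun j : ℕ => (if j = 0 then 1 else 2) * w ^ j) ((1 + w) / (1 - w)) := by
  have hne : 1 - w ≠ 0 := by
    intro h
    rw [sub_eq_zero] at h
    simp [← h] at hw
  have h := ((hasSum_geometric_of_norm_lt_one hw).mul_left 2).sub
    (hasSum_ite_eq (0 : ℕ) (1 : ℂ))
  have e : 2 * (1 - w)⁻¹ - 1 = (1 + w) / (1 - w) := by
    field_simp
    ring
  rw [e] at h
  have e2 : (fun j : ℕ => (if j = 0 then 1 else 2) * w ^ j)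
      = fun j => 2 * w ^ j - if j = 0 then 1 else 0 := by
    ext j
    rcases eq_or_ne j 0 with rfl | hj
    · norm_num
    · simp [hj]
  rwa [e2]

theorem Complex.re_one_add_div_one_sub_nonneg {w : ℂ} (hw : ‖w‖ < 1) :
    0 ≤ ((1 + w) / (1 - w)).re := by
  have h : Complex.normSq w < 1 := by
    rw [← Complex.sq_norm]
    nlinarith [norm_nonneg w]
  rw [Complex.normSq_apply] at h
  rw [Complex.div_re, ← add_div]
  refine div_nonneg ?_ (Complex.normSq_nonneg _)
  simp only [Complex.add_re, Complex.one_re, Complex.sub_re, Complex.add_im, Complex.one_im,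
    Complex.sub_im]
  nlinarith

/-- The Herglotz transform of a function on the circle. -/
noncomputable def herglotz (a : AddCircle T → ℝ) (z : ℂ) : ℂ :=
  ∫ x, (a x : ℂ) * ((1 + z * fourier (-1) x) / (1 - z * fourier (-1) x)) ∂haarAddCircle

omit hT in
theorem norm_mul_fourier_lt_one {z : ℂ} (hz : ‖z‖ < 1) (n : ℤ) (x : AddCircle T) :
    ‖z * fourier n x‖ < 1 := by
  rwa [norm_mul, norm_fourier_apply, mul_one]

theorem herglotz_re_nonneg {a : AddCircle T → ℝ} (ha : ∀ x, 0 ≤ a x) {z : ℂ} (hz : ‖z‖ < 1) :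
    0 ≤ (herglotz a z).re := by
  rw [herglotz]
  by_cases hint : Integrable (fun x => (a x : ℂ) *
      ((1 + z * fourier (-1) x) / (1 - z * fourier (-1) x))) haarAddCircle
  · have := integral_re hint
    simp only [RCLike.re_to_complex] at this
    rw [← this]
    refine integral_nonneg fun x => ?_
    rw [Complex.re_ofReal_mul]
    exact mul_nonneg (ha x)
      (Complex.re_one_add_div_one_sub_nonneg (norm_mul_fourier_lt_one hz _ x))
  · rw [integral_undef hint, Complex.zero_re]

theorem hasSum_herglotz {a : AddCircle T → ℝ} (ha : Integrable a haarAddCircle) {z : ℂ}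
    (hz : ‖z‖ < 1) :
    HasSum (fun j : ℕ => (if j = 0 then 1 else 2) * fourierCoeff (fun x => (a x : ℂ)) j * z ^ j)
      (herglotz a z) := by
  have hint (j : ℕ) : Integrable (fun x => ((if j = 0 then 1 else 2) * z ^ j) *
      (fourier (-(j : ℤ)) x • (a x : ℂ))) haarAddCircle :=
    (ha.ofReal.fourier_smul _).const_mul _
  have hnorm (j : ℕ) : ∫ x, ‖((if j = 0 then 1 else 2) * z ^ j) *
      (fourier (-(j : ℤ)) x • (a x : ℂ))‖ ∂haarAddCircle
      = ‖(if j = 0 then 1 else 2) * z ^ j‖ * ∫ x, ‖a x‖ ∂haarAddCircle := by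
    rw [← integral_const_mul]
    congr with x
    rw [norm_mul, norm_smul, norm_fourier_apply, one_mul, Complex.norm_real]
  have h := hasSum_integral_of_summable_integral_norm hint (by
    simp_rw [hnorm]
    exact (hasSum_one_add_div_one_sub hz).summable.norm.mul_right _)
  have hcoeff (j : ℕ) : ∫ x, ((if j = 0 then 1 else 2) * z ^ j) *
      (fourier (-(j : ℤ)) x • (a x : ℂ)) ∂haarAddCircle
      = (if j = 0 then 1 else 2) * fourierCoeff (fun x => (a x : ℂ)) j * z ^ j := by
    rw [integral_const_mul, fourierCoeff]
    ring
  simp_rw [hcoeff] at h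
  rw [herglotz, integral_congr_ae (ae_of_all _ fun x => ?_)]
  · exact h
  have h2 := (hasSum_one_add_div_one_sub (norm_mul_fourier_lt_one hz (-1) x)).mul_left (a x : ℂ)
  rw [← h2.tsum_eq]
  refine tsum_congr fun j => ?_
  rw [fourier_neg, fourier_neg, fourier_natCast, smul_eq_mul, mul_pow, map_pow]
  ring

theorem norm_fourierCoeff_le (f : AddCircle T → ℂ) (n : ℤ) :
    ‖fourierCoeff f n‖ ≤ ∫ x, ‖f x‖ ∂haarAddCircle := by
  refine (norm_integral_le_integral_norm _).trans_eq ?_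
  simp_rw [norm_smul, norm_fourier_apply, one_mul]

theorem differentiableOn_herglotz {a : AddCircle T → ℝ} (ha : Integrable a haarAddCircle) :
    DifferentiableOn ℂ (herglotz a) (Metric.ball 0 1) := by
  intro z hz
  rw [mem_ball_zero_iff] at hz
  obtain ⟨ρ, hzρ, hρ⟩ := exists_between hz
  have hρ0 : 0 ≤ ρ := (norm_nonneg z).trans hzρ.le
  have hd : DifferentiableOn ℂ (fun z => ∑' j : ℕ,
      (if j = 0 then 1 else 2) * fourierCoeff (fun x => (a x : ℂ)) j * z ^ j)
      (Metric.ball 0 ρ) := by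
    refine Complex.differentiableOn_tsum_of_summable_norm
      (u := fun j : ℕ => (2 * ∫ x, ‖(a x : ℂ)‖ ∂haarAddCircle) * ρ ^ j)
      ((summable_geometric_of_lt_one hρ0 hρ).mul_left _) (fun j => by fun_prop)
      Metric.isOpen_ball fun j w hw => ?_
    rw [mem_ball_zero_iff] at hw
    rw [norm_mul, norm_mul, norm_pow]
    gcongr
    · split_ifs <;> norm_num
    · exact norm_fourierCoeff_le _ _
  have hz2 : Metric.ball (0 : ℂ) ρ ∈ 𝓝 z :=
    Metric.isOpen_ball.mem_nhds (mem_ball_zero_iff.mpr hzρ)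
  refine ((hd.differentiableAt hz2).congr_of_eventuallyEq ?_).differentiableWithinAt
  filter_upwards [hz2] with w hw
  exact (hasSum_herglotz ha ((mem_ball_zero_iff.mp hw).trans hρ)).tsum_eq.symm

/-- The Fourier coefficients of the analytic completion of a real function. -/
noncomputable def completionCoeff (a : AddCircle T → ℝ) (n : ℤ) : ℂ :=
  if n < 0 then 0 else (if n = 0 then 1 else 2) * fourierCoeff (fun x => (a x : ℂ)) n

theorem norm_completionCoeff_sq_le (a : AddCircle T → ℝ) (n : ℤ) :
    ‖completionCoeff a n‖ ^ 2 ≤ 4 * ‖fourierCoeff (fun x => (a x : ℂ)) n‖ ^ 2 := by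
  rw [completionCoeff]
  split_ifs with h h'
  · simp
  · rw [one_mul]
    nlinarith [sq_nonneg ‖fourierCoeff (fun x => (a x : ℂ)) n‖]
  · rw [norm_mul, mul_pow]
    norm_num

theorem exists_memLp_fourierCoeff_eq_completionCoeff {a : AddCircle T → ℝ}
    (ha : MemLp a 2 haarAddCircle) : ∃ A : AddCircle T → ℂ, MemLp A 2 haarAddCircle ∧
      ∀ n, fourierCoeff A n = completionCoeff a n := by
  have hs : Summable fun n => ‖completionCoeff a n‖ ^ 2 :=
    Summable.of_nonneg_of_le (fun _ => by positivity) (norm_completionCoeff_sq_le a)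
      ((hasSum_sq_fourierCoeff_of_memLp ha.ofReal).summable.mul_left 4)
  have hm : Memℓp (completionCoeff a) 2 := by
    refine memℓp_gen ?_
    simpa using hs
  refine ⟨fourierBasis.repr.symm ⟨completionCoeff a, hm⟩, Lp.memLp _, fun n => ?_⟩
  rw [← fourierBasis_repr, LinearIsometryEquiv.apply_symm_apply]

theorem fourierCoeff_ofReal_neg (a : AddCircle T → ℝ) (n : ℤ) :
    (starRingEnd ℂ) (fourierCoeff (fun x => (a x : ℂ)) (-n))
      = fourierCoeff (fun x => (a x : ℂ)) n := by
  rw [← fourierCoeff_star]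
  simp

theorem re_eq_of_fourierCoeff_eq_completionCoeff {a : AddCircle T → ℝ}
    (ha : MemLp a 2 haarAddCircle) {A : AddCircle T → ℂ} (hA : MemLp A 2 haarAddCircle)
    (hc : ∀ n, fourierCoeff A n = completionCoeff a n) :
    ∀ᵐ x ∂haarAddCircle, (A x).re = a x := by
  have hA' : MemLp (fun x => (starRingEnd ℂ) (A x)) 2 haarAddCircle := hA.star
  have ha' : MemLp (fun x => (-2 : ℂ) * (a x : ℂ)) 2 haarAddCircle := ha.ofReal.const_mul _
  have hD := ae_eq_zero_of_fourierCoeff_eq_zero ((hA.add hA').add ha') fun n => by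
    have hi := hA.integrable one_le_two
    have hi' := hA'.integrable one_le_two
    rw [fourierCoeff.add (hi.add hi') (ha'.integrable one_le_two),
      Pi.add_apply, fourierCoeff.add hi hi', Pi.add_apply, fourierCoeff_star,
      fourierCoeff.const_mul, hc, hc]
    have hneg := fourierCoeff_ofReal_neg a n
    rw [completionCoeff, completionCoeff]
    rcases lt_trichotomy n 0 with h | rfl | h
    · rw [if_pos h, if_neg (by lia), if_neg (by lia), map_mul, hneg, map_ofNat]
      ring
    · rw [neg_zero] at hneg
      simp only [lt_irrefl, if_false, if_true, neg_zero, one_mul, hneg]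
      ring
    · rw [if_neg (by lia), if_neg (by lia), if_pos (by lia), map_zero]
      ring
  filter_upwards [hD] with x hx
  have := congrArg Complex.re hx
  simp at this
  linarith

theorem continuous_herglotz_comp {a : AddCircle T → ℝ} (ha : Integrable a haarAddCircle) {r : ℝ}
    (hr0 : 0 ≤ r) (hr1 : r < 1) :
    Continuous fun x : AddCircle T => herglotz a (r * fourier 1 x) := by
  refine (differentiableOn_herglotz ha).continuousOn.comp_continuous
    (continuous_const.mul (fourier 1).continuous) fun x => ?_
  rw [mem_ball_zero_iff]
  refine norm_mul_fourier_lt_one ?_ _ _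
  rwa [Complex.norm_real, Real.norm_of_nonneg hr0]

theorem fourierCoeff_herglotz_comp {a : AddCircle T → ℝ} (ha : Integrable a haarAddCircle) {r : ℝ}
    (hr0 : 0 ≤ r) (hr1 : r < 1) (n : ℤ) :
    fourierCoeff (fun x : AddCircle T => herglotz a (r * fourier 1 x)) n
      = completionCoeff a n * r ^ n.toNat := by
  have hr (z : ℂ) (hz : ‖z‖ = 1) : ‖(r : ℂ) * z‖ < 1 := by
    rwa [norm_mul, hz, mul_one, Complex.norm_real, Real.norm_of_nonneg hr0]
  have hs (z : ℂ) (hz : ‖z‖ = 1) := hasSum_herglotz ha (hr z hz)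
  simp_rw [mul_pow, ← mul_assoc] at hs
  have hc := (hs 1 norm_one).summable.norm
  simp_rw [one_pow, mul_one] at hc
  have h := hasSum_fourierCoeff_mul hc
    (integrable_const (μ := (haarAddCircle : Measure (AddCircle T))) (1 : ℂ))
    (fun x => hs (fourier 1 x) (norm_fourier_apply _ _)) n
  simp_rw [mul_one, fourierCoeff_one] at h
  refine h.unique ?_
  rw [completionCoeff]
  split_ifs with hn h0
  · have h0 (j : ℕ) : ¬ (n - (j : ℤ) = 0) := by lia
    simp only [h0, if_false, mul_zero, zero_mul]
    exact hasSum_zero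
  all_goals
    obtain ⟨m, rfl⟩ := Int.eq_ofNat_of_zero_le (not_lt.mp hn)
    convert hasSum_single m fun j hj => ?_ using 1
    · first
      | simp [show m = 0 by lia]
      | simp [show m ≠ 0 by lia]
    · have hjm : ¬ (m : ℤ) - j = 0 := by lia
      simp only [hjm, if_false, mul_zero]

theorem tendsto_lintegral_herglotz_sub_sq {a : AddCircle T → ℝ} (ha : MemLp a 2 haarAddCircle)
    {A : AddCircle T → ℂ} (hA : MemLp A 2 haarAddCircle)
    (hc : ∀ n, fourierCoeff A n = completionCoeff a n) :
    Tendsto (fun r : ℝ => ∫⁻ x, ‖herglotz a (r * fourier 1 x) - A x‖ₑ ^ 2 ∂haarAddCircle)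
      (𝓝[<] 1) (𝓝 0) := by
  have ha1 := ha.integrable one_le_two
  have hIoo : Set.Ioo (0 : ℝ) 1 ∈ 𝓝[<] (1 : ℝ) := Ioo_mem_nhdsLT one_pos
  have hcs : Summable fun n => ‖completionCoeff a n‖ ^ 2 := by
    simpa only [hc] using (hasSum_sq_fourierCoeff_of_memLp hA).summable
  have hlim : Tendsto (fun r : ℝ => ∑' n : ℤ, ‖completionCoeff a n * (r ^ n.toNat - 1)‖ ^ 2)
      (𝓝[<] 1) (𝓝 (∑' _ : ℤ, 0)) := by
    refine tendsto_tsum_of_dominated_convergence hcs (fun n => ?_) ?_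
    · have : Continuous fun r : ℝ => ‖completionCoeff a n * ((r : ℂ) ^ n.toNat - 1)‖ ^ 2 := by
        fun_prop
      simpa using (this.tendsto 1).mono_left nhdsWithin_le_nhds
    · filter_upwards [hIoo] with r hr n
      rw [Real.norm_of_nonneg (by positivity), norm_mul]
      gcongr
      refine mul_le_of_le_one_right (norm_nonneg _) ?_
      have h1 : r ^ n.toNat ≤ 1 := pow_le_one₀ hr.1.le hr.2.le
      have h2 : 0 ≤ r ^ n.toNat := pow_nonneg hr.1.le _
      rw [← Complex.ofReal_pow, ← Complex.ofReal_one, ← Complex.ofReal_sub, Complex.norm_real,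
        Real.norm_eq_abs, abs_le]
      constructor <;> linarith
  rw [tsum_zero] at hlim
  have hlim2 := (ENNReal.continuous_ofReal.tendsto 0).comp hlim
  rw [ENNReal.ofReal_zero] at hlim2
  refine hlim2.congr' ?_
  filter_upwards [hIoo] with r hr
  have hcont := continuous_herglotz_comp ha1 hr.1.le hr.2
  have hm : MemLp (fun x : AddCircle T => herglotz a (r * fourier 1 x)) 2 haarAddCircle :=
    hcont.memLp_of_hasCompactSupport (HasCompactSupport.of_compactSpace _)
  have h := lintegral_enorm_sq_eq_ofReal_tsum (hm.sub hA)
  simp only [Pi.sub_apply] at h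
  rw [h, Function.comp_apply]
  congr 1
  refine tsum_congr fun n => ?_
  have hsub : fourierCoeff ((fun x : AddCircle T => herglotz a (r * fourier 1 x)) - A) n
      = completionCoeff a n * (r ^ n.toNat - 1) := by
    rw [sub_eq_add_neg, ← neg_one_smul ℂ A,
      fourierCoeff.add (hm.integrable one_le_two) ((hA.integrable one_le_two).smul _),
      Pi.add_apply, fourierCoeff.const_smul, hc, fourierCoeff_herglotz_comp ha1 hr.1.le hr.2,
      smul_eq_mul]
    ring
  rw [hsub]

theorem tendstoInMeasure_herglotz {a : AddCircle T → ℝ} (ha : MemLp a 2 haarAddCircle)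
    {A : AddCircle T → ℂ} (hA : MemLp A 2 haarAddCircle)
    (hc : ∀ n, fourierCoeff A n = completionCoeff a n) :
    TendstoInMeasure haarAddCircle
      (fun (n : ℕ) (x : AddCircle T) => herglotz a ((1 - 1 / ((n : ℝ) + 2) : ℝ) * fourier 1 x))
      atTop A := by
  have hr (n : ℕ) : 0 ≤ 1 - 1 / ((n : ℝ) + 2) ∧ 1 - 1 / ((n : ℝ) + 2) < 1 := by
    have : 1 / ((n : ℝ) + 2) ≤ 1 := by
      rw [div_le_one (by positivity)]
      linarith [n.cast_nonneg (α := ℝ)]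
    have : 0 < 1 / ((n : ℝ) + 2) := by positivity
    constructor <;> linarith
  have hlim : Tendsto (fun n : ℕ => 1 - 1 / ((n : ℝ) + 2)) atTop (𝓝[<] 1) := by
    refine tendsto_nhdsWithin_iff.mpr ⟨?_, Eventually.of_forall fun n => (hr n).2⟩
    have h := (tendsto_one_div_add_atTop_nhds_zero_nat (𝕜 := ℝ)).comp (tendsto_add_atTop_nat 1)
    have h2 := h.const_sub 1
    rw [sub_zero] at h2
    refine h2.congr fun n => ?_
    simp only [Function.comp_apply, Nat.cast_add, Nat.cast_one]
    ring
  refine tendstoInMeasure_of_tendsto_eLpNorm two_ne_zero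
    (fun n => (continuous_herglotz_comp (ha.integrable one_le_two) (hr n).1
      (hr n).2).aestronglyMeasurable) hA.1 ?_
  have h := (tendsto_lintegral_herglotz_sub_sq ha hA hc).comp hlim
  have h2 := ((ENNReal.continuous_rpow_const (y := 1 / 2)).tendsto 0).comp h
  rw [ENNReal.zero_rpow_of_pos (by norm_num)] at h2
  refine h2.congr fun n => ?_
  rw [eLpNorm_eq_lintegral_rpow_enorm_toReal two_ne_zero ENNReal.ofNat_ne_top]
  simp

theorem lintegral_enorm_completion_sq_le {a : AddCircle T → ℝ} (ha : MemLp a 2 haarAddCircle)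
    {A : AddCircle T → ℂ} (hA : MemLp A 2 haarAddCircle)
    (hc : ∀ n, fourierCoeff A n = completionCoeff a n) :
    ∫⁻ x, ‖A x‖ₑ ^ 2 ∂haarAddCircle ≤ 4 * ∫⁻ x, ‖a x‖ₑ ^ 2 ∂haarAddCircle := by
  have h := lintegral_enorm_sq_eq_ofReal_tsum ha.ofReal
  have he (x : AddCircle T) : ‖(RCLike.ofReal (a x) : ℂ)‖ₑ = ‖a x‖ₑ := by
    simp [← ofReal_norm]
  simp_rw [he] at h
  rw [lintegral_enorm_sq_eq_ofReal_tsum hA, h, show (4 : ℝ≥0∞) = ENNReal.ofReal 4 by simp,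
    ← ENNReal.ofReal_mul (by norm_num),
    ← (hasSum_sq_fourierCoeff_of_memLp ha.ofReal).summable.tsum_mul_left 4]
  have hs := (hasSum_sq_fourierCoeff_of_memLp ha.ofReal).summable.mul_left 4
  refine ENNReal.ofReal_le_ofReal (Summable.tsum_le_tsum (fun n => ?_) ?_ hs)
  · rw [hc]
    exact norm_completionCoeff_sq_le a n
  · exact (hasSum_sq_fourierCoeff_of_memLp hA).summable

theorem fourierCoeff_halfPlaneCutoff_mul_eq_zero {a u : AddCircle T → ℝ}
    (ha : MemLp a 2 haarAddCircle) (hu : MemLp u 2 haarAddCircle)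
    (ha0 : ∀ x, 0 ≤ a x) (hu0 : ∀ x, 0 < u x) {A U : AddCircle T → ℂ}
    (hA : MemLp A 2 haarAddCircle) (hU : MemLp U 2 haarAddCircle)
    (hAc : ∀ n, fourierCoeff A n = completionCoeff a n)
    (hUc : ∀ n, fourierCoeff U n = completionCoeff u n)
    {f : AddCircle T → ℂ} (hf : Integrable f haarAddCircle)
    (hf0 : ∀ n : ℤ, n < 0 → fourierCoeff f n = 0) {n : ℤ} (hn : n < 0) :
    fourierCoeff (fun x => (1 - halfPlaneCutoff (A x) (U x)) ^ 2 * f x) n = 0 := by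
  obtain ⟨ns, hns, hnsA⟩ := (tendstoInMeasure_herglotz ha hA hAc).exists_seq_tendsto_ae
  obtain ⟨ms, hms, hmsU⟩ := ((tendstoInMeasure_herglotz hu hU hUc).comp
    hns.tendsto_atTop).exists_seq_tendsto_ae
  set ρ : ℕ → ℝ := fun i => 1 - 1 / ((ns (ms i) : ℝ) + 2) with hρ
  set δ : ℕ → ℝ := fun i => 1 / ((i : ℝ) + 1) with hδ
  have hδ0 (i : ℕ) : 0 < δ i := by positivity
  have hρ0 (i : ℕ) : 0 < ρ i := by
    have : 1 / ((ns (ms i) : ℝ) + 2) < 1 := by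
      rw [div_lt_one (by positivity)]
      linarith [(ns (ms i)).cast_nonneg (α := ℝ)]
    simp only [hρ]
    linarith
  have hρ1 (i : ℕ) : ρ i < 1 := by
    have : 0 < 1 / ((ns (ms i) : ℝ) + 2) := by positivity
    simp only [hρ]
    linarith
  have hball (i : ℕ) {z : ℂ} (hz : z ∈ Metric.ball (0 : ℂ) (ρ i)⁻¹) : ‖(ρ i : ℂ) * z‖ < 1 := by
    rw [mem_ball_zero_iff] at hz
    rw [norm_mul, Complex.norm_real, Real.norm_of_nonneg (hρ0 i).le]
    calc ρ i * ‖z‖ < ρ i * (ρ i)⁻¹ := by gcongr; exact hρ0 i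
      _ = 1 := mul_inv_cancel₀ (hρ0 i).ne'
  have hsphere (i : ℕ) (x : AddCircle T) : fourier 1 x ∈ Metric.ball (0 : ℂ) (ρ i)⁻¹ := by
    rw [mem_ball_zero_iff, norm_fourier_apply]
    exact (one_lt_inv₀ (hρ0 i)).mpr (hρ1 i)
  have hdiff {b : AddCircle T → ℝ} (hb : MemLp b 2 haarAddCircle) (i : ℕ) :
      DifferentiableOn ℂ (fun z => herglotz b (ρ i * z) + δ i) (Metric.ball 0 (ρ i)⁻¹) := by
    refine DifferentiableOn.add_const _ ?_
    exact (differentiableOn_herglotz (hb.integrable one_le_two)).comp (by fun_prop)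
      fun z hz => mem_ball_zero_iff.mpr (hball i hz)
  have hpos {b : AddCircle T → ℝ} (hb : ∀ x, 0 ≤ b x) (i : ℕ) (z : ℂ)
      (hz : z ∈ Metric.ball (0 : ℂ) (ρ i)⁻¹) : 0 < (herglotz b (ρ i * z) + δ i).re := by
    have := herglotz_re_nonneg hb (hball i hz)
    rw [Complex.add_re, Complex.ofReal_re]
    linarith [hδ0 i]
  set q : ℕ → ℂ → ℂ := fun i z =>
    halfPlaneCutoff (herglotz a (ρ i * z) + δ i) (herglotz u (ρ i * z) + δ i) with hq
  have hqd (i : ℕ) : DifferentiableOn ℂ (q i) (Metric.ball 0 (ρ i)⁻¹) :=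
    (hdiff ha i).halfPlaneCutoff (hdiff hu i) (hpos ha0 i) (hpos (fun x => (hu0 x).le) i)
  have hzero (i : ℕ) : fourierCoeff (fun x => (1 - q i (fourier 1 x)) ^ 2 * f x) n = 0 :=
    fourierCoeff_mul_eq_zero_of_differentiableOn ((one_lt_inv₀ (hρ0 i)).mpr (hρ1 i))
      (F := fun z => (1 - q i z) ^ 2) (((hqd i).const_sub 1).pow 2) hf hf0 hn
  have hqbound (i : ℕ) (x : AddCircle T) : ‖(1 - q i (fourier 1 x)) ^ 2‖ ≤ 4 := by
    have h1 : ‖q i (fourier 1 x)‖ ≤ 1 :=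
      norm_halfPlaneCutoff_le_one (hpos ha0 i _ (hsphere i x)).le
        (hpos (fun x => (hu0 x).le) i _ (hsphere i x)).le
    have h2 := norm_sub_le (1 : ℂ) (q i (fourier 1 x))
    rw [norm_one] at h2
    rw [norm_pow]
    nlinarith [norm_nonneg (1 - q i (fourier 1 x))]
  have hlim : Tendsto (fun i => fourierCoeff (fun x => (1 - q i (fourier 1 x)) ^ 2 * f x) n) atTop
      (𝓝 (fourierCoeff (fun x => (1 - halfPlaneCutoff (A x) (U x)) ^ 2 * f x) n)) := by
    refine tendsto_integral_of_dominated_convergence (fun x => 4 * ‖f x‖) (fun i => ?_)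
      (hf.norm.const_mul 4) (fun i => ae_of_all _ fun x => ?_) ?_
    · have hcont : Continuous fun x : AddCircle T => (1 - q i (fourier 1 x)) ^ 2 :=
        (continuous_const.sub ((hqd i).continuousOn.comp_continuous (fourier 1).continuous
          (hsphere i))).pow 2
      exact (fourier (-n)).continuous.aestronglyMeasurable.smul
        (hcont.aestronglyMeasurable.mul hf.1)
    · rw [norm_smul, norm_fourier_apply, one_mul, norm_mul]
      gcongr
      exact hqbound i x
    · filter_upwards [hnsA, hmsU, re_eq_of_fourierCoeff_eq_completionCoeff ha hA hAc,
        re_eq_of_fourierCoeff_eq_completionCoeff hu hU hUc] with x hxA hxU hA' hU'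
      have hδlim : Tendsto (fun i => (δ i : ℂ)) atTop (𝓝 0) := by
        have := (Complex.continuous_ofReal.tendsto 0).comp
          (tendsto_one_div_add_atTop_nhds_zero_nat (𝕜 := ℝ))
        rwa [Complex.ofReal_zero] at this
      have h1 := (hxA.comp hms.tendsto_atTop).add hδlim
      have h2 := hxU.add hδlim
      rw [add_zero] at h1 h2
      have h3 := (continuousAt_halfPlaneCutoff (z := A x) (w := U x) (hA' ▸ ha0 x)
        (hU' ▸ hu0 x)).tendsto.comp (h1.prodMk_nhds h2)
      exact (((h3.const_sub 1).pow 2).mul_const (f x)).const_smul _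
  exact tendsto_nhds_unique (hlim.congr hzero) tendsto_const_nhds

end Completion

theorem norm_one_sub_halfPlaneCutoff_sq_mul_add_le {z w : ℂ} (hz : 0 ≤ z.re) (hw : 0 < w.re)
    {t : ℝ} (ht : 0 < t) (c d : ℂ) :
    ‖(1 - halfPlaneCutoff z w) ^ 2 * (c + d)‖
      ≤ 4 * ‖c‖ + 16 * (t ^ 2 / ‖w‖ ^ 2 * ‖d‖ ^ 2 + 1 / t ^ 2 * ‖z‖ ^ 2) := by
  have hw0 : 0 < ‖w‖ := hw.trans_le (Complex.re_le_norm w)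
  have h1 := norm_halfPlaneCutoff_le_one hz hw.le
  have h2 := norm_one_sub_halfPlaneCutoff_sq_mul_le hz hw
  have h3 := norm_sub_le (1 : ℂ) (halfPlaneCutoff z w)
  rw [norm_one] at h3
  rw [← le_div_iff₀ hw0] at h2
  have h4 : ‖1 - halfPlaneCutoff z w‖ ^ 2 ≤ 4 := by
    nlinarith [norm_nonneg (1 - halfPlaneCutoff z w)]
  have h5 : ‖z‖ / ‖w‖ * ‖d‖ ≤ t ^ 2 / ‖w‖ ^ 2 * ‖d‖ ^ 2 + 1 / t ^ 2 * ‖z‖ ^ 2 := by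
    have e1 : ‖z‖ / ‖w‖ * ‖d‖ = (t / ‖w‖ * ‖d‖) * (1 / t * ‖z‖) := by
      field_simp
    have e2 : t ^ 2 / ‖w‖ ^ 2 * ‖d‖ ^ 2 + 1 / t ^ 2 * ‖z‖ ^ 2
        = (t / ‖w‖ * ‖d‖) ^ 2 + (1 / t * ‖z‖) ^ 2 := by
      field_simp
    rw [e1, e2]
    nlinarith [sq_nonneg (t / ‖w‖ * ‖d‖ - 1 / t * ‖z‖), sq_nonneg (t / ‖w‖ * ‖d‖),
      sq_nonneg (1 / t * ‖z‖)]
  calc ‖(1 - halfPlaneCutoff z w) ^ 2 * (c + d)‖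
      ≤ ‖1 - halfPlaneCutoff z w‖ ^ 2 * (‖c‖ + ‖d‖) := by
        rw [norm_mul, norm_pow]
        gcongr
        exact norm_add_le _ _
    _ = ‖1 - halfPlaneCutoff z w‖ ^ 2 * ‖c‖ + ‖1 - halfPlaneCutoff z w‖ ^ 2 * ‖d‖ := mul_add _ _ _
    _ ≤ 4 * ‖c‖ + 16 * ‖z‖ / ‖w‖ * ‖d‖ := by gcongr
    _ = 4 * ‖c‖ + 16 * (‖z‖ / ‖w‖ * ‖d‖) := by ring
    _ ≤ _ := by gcongr

theorem norm_one_sub_one_sub_halfPlaneCutoff_sq_mul_add_sq_le {z w : ℂ} (hw : 0 < w.re)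
    {t : ℝ} (ht : 0 < t) {c : ℂ} (d : ℂ) (hz : t * √‖c‖ ≤ z.re) :
    ‖(1 - (1 - halfPlaneCutoff z w) ^ 2) * (c + d)‖ ^ 2
      ≤ 18 * (‖d‖ ^ 2 + ‖w‖ ^ 2 / t ^ 2 * ‖c‖) := by
  have hz0 : 0 ≤ z.re := le_trans (by positivity) hz
  have h1 := norm_halfPlaneCutoff_le_one hz0 hw.le
  have h2 := norm_sq_mul_norm_halfPlaneCutoff_le hz0 hw
  set q := halfPlaneCutoff z w
  have h3 : ‖1 - (1 - q) ^ 2‖ ≤ 3 * ‖q‖ := by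
    rw [show 1 - (1 - q) ^ 2 = (2 - q) * q by ring, norm_mul]
    gcongr
    have := norm_sub_le (2 : ℂ) q
    rw [Complex.norm_ofNat] at this
    linarith
  have h4 : t ^ 2 * ‖c‖ ≤ ‖z‖ ^ 2 := by
    calc t ^ 2 * ‖c‖ = (t * √‖c‖) ^ 2 := by rw [mul_pow, Real.sq_sqrt (norm_nonneg _)]
      _ ≤ ‖z‖ ^ 2 := by
        gcongr
        exact hz.trans (Complex.re_le_norm z)
  have h5 : ‖q‖ * ‖c‖ ≤ ‖w‖ ^ 2 / t ^ 2 := by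
    rw [le_div_iff₀ (by positivity)]
    calc ‖q‖ * ‖c‖ * t ^ 2 = (t ^ 2 * ‖c‖) * ‖q‖ := by ring
      _ ≤ ‖z‖ ^ 2 * ‖q‖ := by gcongr
      _ ≤ _ := h2
  have h6 : ‖(1 - (1 - q) ^ 2) * (c + d)‖ ≤ 3 * (‖q‖ * ‖c‖ + ‖d‖) := by
    calc ‖(1 - (1 - q) ^ 2) * (c + d)‖ ≤ 3 * ‖q‖ * (‖c‖ + ‖d‖) := by
          rw [norm_mul]
          gcongr
          exact norm_add_le _ _
      _ = 3 * (‖q‖ * ‖c‖ + ‖q‖ * ‖d‖) := by ring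
      _ ≤ 3 * (‖q‖ * ‖c‖ + ‖d‖) := by
          gcongr
          exact mul_le_of_le_one_left (norm_nonneg _) h1
  have h7 : (‖q‖ * ‖c‖) ^ 2 ≤ ‖w‖ ^ 2 / t ^ 2 * ‖c‖ := by
    rw [sq]
    gcongr
    exact mul_le_of_le_one_left (norm_nonneg _) h1
  calc ‖(1 - (1 - q) ^ 2) * (c + d)‖ ^ 2 ≤ (3 * (‖q‖ * ‖c‖ + ‖d‖)) ^ 2 := by gcongr
    _ ≤ 18 * (‖d‖ ^ 2 + (‖q‖ * ‖c‖) ^ 2) := by nlinarith [sq_nonneg (‖q‖ * ‖c‖ - ‖d‖)]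
    _ ≤ _ := by gcongr

theorem measurable_halfPlaneCutoff :
    Measurable fun p : ℂ × ℂ => halfPlaneCutoff p.1 p.2 := by
  unfold halfPlaneCutoff Complex.sqrt
  fun_prop

theorem eLpLqNorm_one_one (g : ℕ → 𝕋 → ℂ) :
    eLpLqNorm 1 1 g = ∫⁻ x, ∑' k, ‖g k x‖ₑ ∂μ𝕋 := by
  simp [eLpLqNorm, enorm]

theorem eLpLqNorm_one_two (g : ℕ → 𝕋 → ℂ) :
    eLpLqNorm 1 2 g = ∫⁻ x, (∑' k, ‖g k x‖ₑ ^ 2) ^ (1 / 2 : ℝ) ∂μ𝕋 := by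
  simp [eLpLqNorm, enorm]

theorem enorm_le_rpow_tsum_sq (c : ℕ → ℂ) (k : ℕ) :
    ‖c k‖ₑ ≤ (∑' j, ‖c j‖ₑ ^ 2) ^ (1 / 2 : ℝ) := by
  calc ‖c k‖ₑ = (‖c k‖ₑ ^ 2) ^ (1 / 2 : ℝ) := by
        rw [← ENNReal.rpow_natCast, ← ENNReal.rpow_mul]
        norm_num
    _ ≤ _ := ENNReal.rpow_le_rpow (ENNReal.le_tsum k) (by norm_num)

theorem MemLpLq.integrable_one_one {g : ℕ → 𝕋 → ℂ} (hg : MemLpLq 1 1 g) (k : ℕ) :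
    Integrable (g k) μ𝕋 := by
  refine ⟨hg.1 k, lt_of_le_of_lt ?_ hg.2⟩
  rw [eLpLqNorm_one_one]
  exact lintegral_mono fun x => ENNReal.le_tsum (f := fun k => ‖g k x‖ₑ) k

theorem MemLpLq.integrable_one_two {g : ℕ → 𝕋 → ℂ} (hg : MemLpLq 1 2 g) (k : ℕ) :
    Integrable (g k) μ𝕋 := by
  refine ⟨hg.1 k, lt_of_le_of_lt ?_ hg.2⟩
  rw [eLpLqNorm_one_two]
  exact lintegral_mono fun x => enorm_le_rpow_tsum_sq (fun k => g k x) k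

theorem rpow_half_sq (c : ℝ≥0∞) : (c ^ (1 / 2 : ℝ)) ^ 2 = c := by
  rw [← ENNReal.rpow_natCast, ← ENNReal.rpow_mul]
  norm_num

theorem tsum_enorm_one_sub_halfPlaneCutoff_sq_mul_add_le {t : ℝ} (ht : 0 < t) {w : ℂ}
    (hw : 0 < w.re) {z : ℕ → ℂ} (hz : ∀ k, 0 ≤ (z k).re) (a b : ℕ → ℂ)
    (hb : (∑' k, ‖b k‖ₑ ^ 2) ^ (1 / 2 : ℝ) ≤ ENNReal.ofReal (‖w‖ ^ 2 / t)) :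
    ∑' k, ‖(1 - halfPlaneCutoff (z k) w) ^ 2 * (a k + b k)‖ₑ ≤ 4 * ∑' k, ‖a k‖ₑ +
      16 * (‖w‖ₑ ^ 2 + ENNReal.ofReal (1 / t ^ 2) * ∑' k, ‖z k‖ₑ ^ 2) := by
  have hw0 : 0 < ‖w‖ := hw.trans_le (Complex.re_le_norm _)
  have hk (k : ℕ) : ‖(1 - halfPlaneCutoff (z k) w) ^ 2 * (a k + b k)‖ₑ ≤ 4 * ‖a k‖ₑ +
      16 * (ENNReal.ofReal (t ^ 2 / ‖w‖ ^ 2) * ‖b k‖ₑ ^ 2 +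
        ENNReal.ofReal (1 / t ^ 2) * ‖z k‖ₑ ^ 2) := by
    have h := ENNReal.ofReal_le_ofReal
      (norm_one_sub_halfPlaneCutoff_sq_mul_add_le (hz k) hw ht (a k) (b k))
    rw [ENNReal.ofReal_add (by positivity) (by positivity), ENNReal.ofReal_mul (by positivity),
      ENNReal.ofReal_mul (by positivity), ENNReal.ofReal_add (by positivity) (by positivity),
      ENNReal.ofReal_mul (by positivity), ENNReal.ofReal_mul (by positivity),
      ENNReal.ofReal_pow (norm_nonneg _), ENNReal.ofReal_pow (norm_nonneg _)] at h
    simpa only [ofReal_norm, ENNReal.ofReal_ofNat] using h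
  refine (ENNReal.tsum_le_tsum hk).trans ?_
  rw [ENNReal.tsum_add, ENNReal.tsum_mul_left, ENNReal.tsum_mul_left, ENNReal.tsum_add,
    ENNReal.tsum_mul_left, ENNReal.tsum_mul_left, ← rpow_half_sq (∑' k, ‖b k‖ₑ ^ 2)]
  gcongr
  calc ENNReal.ofReal (t ^ 2 / ‖w‖ ^ 2) * ((∑' k, ‖b k‖ₑ ^ 2) ^ (1 / 2 : ℝ)) ^ 2
      ≤ ENNReal.ofReal (t ^ 2 / ‖w‖ ^ 2) * ENNReal.ofReal (‖w‖ ^ 2 / t) ^ 2 := by gcongr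
    _ = ENNReal.ofReal (‖w‖ ^ 2) := by
      rw [← ENNReal.ofReal_pow (by positivity), ← ENNReal.ofReal_mul (by positivity)]
      congr 1
      field_simp
    _ = ‖w‖ₑ ^ 2 := by rw [ENNReal.ofReal_pow (norm_nonneg _), ofReal_norm]

theorem rpow_tsum_enorm_one_sub_one_sub_halfPlaneCutoff_sq_mul_add_le {t : ℝ} (ht : 0 < t) {w : ℂ}
    (hw : 0 < w.re) {z a : ℕ → ℂ} (hz : ∀ k, t * √‖a k‖ = (z k).re) (b : ℕ → ℂ)
    (ha : ∑' k, ‖a k‖ₑ ≤ ENNReal.ofReal (‖w‖ ^ 2))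
    (hb : (∑' k, ‖b k‖ₑ ^ 2) ^ (1 / 2 : ℝ) ≤ ENNReal.ofReal (‖w‖ ^ 2 / t)) :
    ENNReal.ofReal t *
        (∑' k, ‖(1 - (1 - halfPlaneCutoff (z k) w) ^ 2) * (a k + b k)‖ₑ ^ 2) ^ (1 / 2 : ℝ) ≤
      6 * ‖w‖ₑ ^ 2 := by
  have hk (k : ℕ) : ‖(1 - (1 - halfPlaneCutoff (z k) w) ^ 2) * (a k + b k)‖ₑ ^ 2 ≤
      18 * (‖b k‖ₑ ^ 2 + ENNReal.ofReal (‖w‖ ^ 2 / t ^ 2) * ‖a k‖ₑ) := by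
    have h := ENNReal.ofReal_le_ofReal
      (norm_one_sub_one_sub_halfPlaneCutoff_sq_mul_add_sq_le hw ht (b k) (hz k).le)
    rw [ENNReal.ofReal_mul (by positivity), ENNReal.ofReal_add (by positivity) (by positivity),
      ENNReal.ofReal_mul (by positivity), ENNReal.ofReal_pow (norm_nonneg _),
      ENNReal.ofReal_pow (norm_nonneg _)] at h
    simpa only [ofReal_norm, ENNReal.ofReal_ofNat] using h
  have hsq : ∑' k, ‖(1 - (1 - halfPlaneCutoff (z k) w) ^ 2) * (a k + b k)‖ₑ ^ 2 ≤
      ENNReal.ofReal (6 * (‖w‖ ^ 2 / t)) ^ 2 := by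
    calc ∑' k, ‖(1 - (1 - halfPlaneCutoff (z k) w) ^ 2) * (a k + b k)‖ₑ ^ 2
        ≤ 18 * (((∑' k, ‖b k‖ₑ ^ 2) ^ (1 / 2 : ℝ)) ^ 2 +
            ENNReal.ofReal (‖w‖ ^ 2 / t ^ 2) * ∑' k, ‖a k‖ₑ) := by
          refine (ENNReal.tsum_le_tsum hk).trans_eq ?_
          rw [ENNReal.tsum_mul_left, ENNReal.tsum_add, ENNReal.tsum_mul_left, rpow_half_sq]
      _ ≤ 18 * (ENNReal.ofReal (‖w‖ ^ 2 / t) ^ 2 +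
            ENNReal.ofReal (‖w‖ ^ 2 / t ^ 2) * ENNReal.ofReal (‖w‖ ^ 2)) := by gcongr
      _ = ENNReal.ofReal (6 * (‖w‖ ^ 2 / t)) ^ 2 := by
          rw [← ENNReal.ofReal_pow (by positivity), ← ENNReal.ofReal_mul (by positivity),
            ← ENNReal.ofReal_add (by positivity) (by positivity),
            ← ENNReal.ofReal_ofNat, ← ENNReal.ofReal_mul (by positivity),
            ← ENNReal.ofReal_pow (by positivity)]
          congr 1
          field_simp
          ring
  calc ENNReal.ofReal t *
        (∑' k, ‖(1 - (1 - halfPlaneCutoff (z k) w) ^ 2) * (a k + b k)‖ₑ ^ 2) ^ (1 / 2 : ℝ)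
      ≤ ENNReal.ofReal t * (ENNReal.ofReal (6 * (‖w‖ ^ 2 / t)) ^ 2) ^ (1 / 2 : ℝ) := by gcongr
    _ = ENNReal.ofReal t * ENNReal.ofReal (6 * (‖w‖ ^ 2 / t)) := by
        rw [← ENNReal.rpow_natCast, ← ENNReal.rpow_mul]
        norm_num
    _ = 6 * ‖w‖ₑ ^ 2 := by
        rw [← ENNReal.ofReal_mul ht.le, ← ofReal_norm, ← ENNReal.ofReal_pow (norm_nonneg _),
          ← ENNReal.ofReal_ofNat, ← ENNReal.ofReal_mul (by positivity)]
        congr 1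
        field_simp

theorem AEMeasurable.halfPlaneCutoff {z w : 𝕋 → ℂ} (hz : AEMeasurable z μ𝕋)
    (hw : AEMeasurable w μ𝕋) : AEMeasurable (fun x => halfPlaneCutoff (z x) (w x)) μ𝕋 :=
  Measurable.comp_aemeasurable (g := fun p : ℂ × ℂ => _root_.halfPlaneCutoff p.1 p.2)
    (f := fun x => (z x, w x)) measurable_halfPlaneCutoff (hz.prodMk hw)

theorem exists_analytic_decomposition {t : ℝ} (ht : 0 < t) {f g₀ g₁ : ℕ → 𝕋 → ℂ}
    (hf : ∀ k, Integrable (f k) μ𝕋) (hf0 : ∀ k, ∀ n : ℤ, n < 0 → fourierCoeff (f k) n = 0)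
    (hg₀ : MemLpLq 1 1 g₀) (hg₁ : MemLpLq 1 2 g₁) (hfg : f = g₀ + g₁) {ε : ℝ} (hε : 0 < ε) :
    ∃ h₀ h₁ : ℕ → 𝕋 → ℂ, MemHpLq 1 1 h₀ ∧ MemHpLq 1 2 h₁ ∧ f = h₀ + h₁ ∧
      eLpLqNorm 1 1 h₀ + ENNReal.ofReal t * eLpLqNorm 1 2 h₁ ≤
        200 * (eLpLqNorm 1 1 g₀ + ENNReal.ofReal t * eLpLqNorm 1 2 g₁ + ENNReal.ofReal ε) := by
  set S₀ : 𝕋 → ℝ≥0∞ := fun x => ∑' k, ‖g₀ k x‖ₑ with hS₀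
  set S₁ : 𝕋 → ℝ≥0∞ := fun x => (∑' k, ‖g₁ k x‖ₑ ^ 2) ^ (1 / 2 : ℝ) with hS₁
  have hS₀m : AEMeasurable S₀ μ𝕋 := AEMeasurable.tsum fun k => (hg₀.1 k).enorm
  have hS₁m : AEMeasurable S₁ μ𝕋 :=
    (AEMeasurable.tsum fun k => (hg₁.1 k).enorm.pow_const 2).pow_const _
  have hN₀ : eLpLqNorm 1 1 g₀ = ∫⁻ x, S₀ x ∂μ𝕋 := eLpLqNorm_one_one g₀
  have hN₁ : eLpLqNorm 1 2 g₁ = ∫⁻ x, S₁ x ∂μ𝕋 := eLpLqNorm_one_two g₁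
  have hKm : AEMeasurable (fun x => S₀ x + ENNReal.ofReal t * S₁ x) μ𝕋 :=
    hS₀m.add (hS₁m.const_mul _)
  have hKint : ∫⁻ x, S₀ x + ENNReal.ofReal t * S₁ x ∂μ𝕋
      = eLpLqNorm 1 1 g₀ + ENNReal.ofReal t * eLpLqNorm 1 2 g₁ := by
    rw [lintegral_add_left' hS₀m, lintegral_const_mul'' _ hS₁m, hN₀, hN₁]
  have hKtop : ∫⁻ x, S₀ x + ENNReal.ofReal t * S₁ x ∂μ𝕋 ≠ ⊤ := by
    rw [hKint]
    exact ENNReal.add_ne_top.mpr ⟨hg₀.2.ne, ENNReal.mul_ne_top ENNReal.ofReal_ne_top hg₁.2.ne⟩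
  set u : 𝕋 → ℝ := fun x => √((S₀ x + ENNReal.ofReal t * S₁ x).toReal + ε) with hu
  have hu_sq (x : 𝕋) : u x ^ 2 = (S₀ x + ENNReal.ofReal t * S₁ x).toReal + ε :=
    Real.sq_sqrt (by positivity)
  have hu0 (x : 𝕋) : 0 < u x := Real.sqrt_pos.mpr (by positivity)
  have huL : MemLp u 2 μ𝕋 := by
    refine (memLp_two_iff_integrable_sq ?_).mpr ?_
    · exact (hKm.ennreal_toReal.add_const ε).sqrt.aestronglyMeasurable
    · simp_rw [hu_sq]
      exact (integrable_toReal_of_lintegral_ne_top hKm hKtop).add (integrable_const ε)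
  have huN : ∫⁻ x, ‖u x‖ₑ ^ 2 ∂μ𝕋
      ≤ eLpLqNorm 1 1 g₀ + ENNReal.ofReal t * eLpLqNorm 1 2 g₁ + ENNReal.ofReal ε := by
    calc ∫⁻ x, ‖u x‖ₑ ^ 2 ∂μ𝕋
        ≤ ∫⁻ x, (S₀ x + ENNReal.ofReal t * S₁ x) + ENNReal.ofReal ε ∂μ𝕋 := by
          refine lintegral_mono fun x => ?_
          simp only
          rw [← ofReal_norm, Real.norm_of_nonneg (hu0 x).le, ← ENNReal.ofReal_pow (hu0 x).le,
            hu_sq, ENNReal.ofReal_add ENNReal.toReal_nonneg hε.le]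
          gcongr
          exact ENNReal.ofReal_toReal_le
      _ = _ := by rw [lintegral_add_right _ measurable_const, hKint, lintegral_const,
                    measure_univ, mul_one]
  set a : ℕ → 𝕋 → ℝ := fun k x => t * √‖g₀ k x‖ with ha
  have ha0 (k : ℕ) (x : 𝕋) : 0 ≤ a k x := by positivity
  have ha_sq (k : ℕ) (x : 𝕋) : a k x ^ 2 = t ^ 2 * ‖g₀ k x‖ := by
    rw [ha, mul_pow, Real.sq_sqrt (norm_nonneg _)]
  have haL (k : ℕ) : MemLp (a k) 2 μ𝕋 := by
    refine (memLp_two_iff_integrable_sq ?_).mpr ?_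
    · exact ((hg₀.1 k).norm.aemeasurable.sqrt.const_mul t).aestronglyMeasurable
    · simp_rw [ha_sq]
      exact (hg₀.integrable_one_one k).norm.const_mul _
  have haN (k : ℕ) : ∫⁻ x, ‖a k x‖ₑ ^ 2 ∂μ𝕋 = ENNReal.ofReal (t ^ 2) * ∫⁻ x, ‖g₀ k x‖ₑ ∂μ𝕋 := by
    rw [← lintegral_const_mul'' _ (hg₀.1 k).enorm]
    refine lintegral_congr fun x => ?_
    rw [← ofReal_norm, Real.norm_of_nonneg (ha0 k x), ← ENNReal.ofReal_pow (ha0 k x), ha_sq,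
      ENNReal.ofReal_mul (by positivity), ofReal_norm]
  obtain ⟨U, hUL, hUc⟩ := exists_memLp_fourierCoeff_eq_completionCoeff huL
  choose A hAL hAc using fun k => exists_memLp_fourierCoeff_eq_completionCoeff (haL k)
  have hUN := lintegral_enorm_completion_sq_le huL hUL hUc
  have hAN (k : ℕ) := lintegral_enorm_completion_sq_le (haL k) (hAL k) (hAc k)
  simp_rw [haN] at hAN
  set h₀ : ℕ → 𝕋 → ℂ := fun k x => (1 - halfPlaneCutoff (A k x) (U x)) ^ 2 * f k x with hh₀
  set h₁ : ℕ → 𝕋 → ℂ := fun k x => (1 - (1 - halfPlaneCutoff (A k x) (U x)) ^ 2) * f k x with hh₁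
  have hqm (k : ℕ) : AEMeasurable (fun x => halfPlaneCutoff (A k x) (U x)) μ𝕋 :=
    (hAL k).1.aemeasurable.halfPlaneCutoff hUL.1.aemeasurable
  have hh₀m (k : ℕ) : AEStronglyMeasurable (h₀ k) μ𝕋 :=
    ((((hqm k).const_sub 1).pow_const 2).mul (hf k).1.aemeasurable).aestronglyMeasurable
  have hh₁m (k : ℕ) : AEStronglyMeasurable (h₁ k) μ𝕋 :=
    (((((hqm k).const_sub 1).pow_const 2).const_sub 1).mul
      (hf k).1.aemeasurable).aestronglyMeasurable
  have hsum : f = h₀ + h₁ := by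
    ext k x
    simp only [hh₀, hh₁, Pi.add_apply]
    ring
  have hpt : ∀ᵐ x ∂μ𝕋, 0 < (U x).re ∧ (∀ k, t * √‖g₀ k x‖ = (A k x).re) ∧
      S₀ x ≤ ENNReal.ofReal (‖U x‖ ^ 2) ∧ S₁ x ≤ ENNReal.ofReal (‖U x‖ ^ 2 / t) := by
    filter_upwards [re_eq_of_fourierCoeff_eq_completionCoeff huL hUL hUc,
      ae_all_iff.mpr fun k => re_eq_of_fourierCoeff_eq_completionCoeff (haL k) (hAL k) (hAc k),
      ae_lt_top' hKm hKtop] with x hUx hAx hKx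
    have hK : S₀ x + ENNReal.ofReal t * S₁ x ≤ ENNReal.ofReal (‖U x‖ ^ 2) := by
      rw [← ENNReal.ofReal_toReal hKx.ne]
      refine ENNReal.ofReal_le_ofReal ?_
      calc (S₀ x + ENNReal.ofReal t * S₁ x).toReal ≤ u x ^ 2 := by
            rw [hu_sq]
            linarith
        _ ≤ ‖U x‖ ^ 2 := by
            gcongr
            exact hUx ▸ Complex.re_le_norm _
    refine ⟨hUx ▸ hu0 x, fun k => (hAx k).symm, le_self_add.trans hK, ?_⟩
    rw [ENNReal.ofReal_div_of_pos ht, ENNReal.le_div_iff_mul_le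
      (Or.inl (ENNReal.ofReal_pos.mpr ht).ne') (Or.inl ENNReal.ofReal_ne_top), mul_comm]
    exact le_add_self.trans hK
  have hpt₀ : ∀ᵐ x ∂μ𝕋, ∑' k, ‖h₀ k x‖ₑ ≤ 4 * S₀ x + 16 * (‖U x‖ₑ ^ 2 +
      ENNReal.ofReal (1 / t ^ 2) * ∑' k, ‖A k x‖ₑ ^ 2) := by
    filter_upwards [hpt] with x ⟨hUx, hAx, _, hS₁x⟩
    simp only [hh₀, hfg, Pi.add_apply]
    exact tsum_enorm_one_sub_halfPlaneCutoff_sq_mul_add_le ht hUx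
      (fun k => (hAx k).symm ▸ by positivity) _ _ hS₁x
  have hpt₁ : ∀ᵐ x ∂μ𝕋, ENNReal.ofReal t * (∑' k, ‖h₁ k x‖ₑ ^ 2) ^ (1 / 2 : ℝ)
      ≤ 6 * ‖U x‖ₑ ^ 2 := by
    filter_upwards [hpt] with x ⟨hUx, hAx, hS₀x, hS₁x⟩
    simp only [hh₁, hfg, Pi.add_apply]
    exact rpow_tsum_enorm_one_sub_one_sub_halfPlaneCutoff_sq_mul_add_le ht hUx hAx _ hS₀x hS₁x
  set κ := eLpLqNorm 1 1 g₀ + ENNReal.ofReal t * eLpLqNorm 1 2 g₁ + ENNReal.ofReal ε with hκ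
  have hκtop : κ < ⊤ := by
    rw [hκ, ← hKint]
    exact ENNReal.add_lt_top.mpr ⟨hKtop.lt_top, ENNReal.ofReal_lt_top⟩
  have hκ₀ : eLpLqNorm 1 1 g₀ ≤ κ := le_self_add.trans le_self_add
  have hUκ : ∫⁻ x, ‖U x‖ₑ ^ 2 ∂μ𝕋 ≤ 4 * κ := hUN.trans (by gcongr)
  have hAκ : ENNReal.ofReal (1 / t ^ 2) * ∫⁻ x, ∑' k, ‖A k x‖ₑ ^ 2 ∂μ𝕋 ≤ 4 * κ := by
    rw [lintegral_tsum fun k => (hAL k).1.enorm.pow_const 2]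
    calc ENNReal.ofReal (1 / t ^ 2) * ∑' k, ∫⁻ x, ‖A k x‖ₑ ^ 2 ∂μ𝕋
        ≤ ENNReal.ofReal (1 / t ^ 2) *
            ∑' k, 4 * (ENNReal.ofReal (t ^ 2) * ∫⁻ x, ‖g₀ k x‖ₑ ∂μ𝕋) := by
          gcongr with k
          exact hAN k
      _ = (ENNReal.ofReal (1 / t ^ 2) * ENNReal.ofReal (t ^ 2)) * (4 * eLpLqNorm 1 1 g₀) := by
          rw [ENNReal.tsum_mul_left, ENNReal.tsum_mul_left, eLpLqNorm_one_one,
            lintegral_tsum fun k => (hg₀.1 k).enorm]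
          ring
      _ = 4 * eLpLqNorm 1 1 g₀ := by
          rw [← ENNReal.ofReal_mul (by positivity), one_div_mul_cancel (by positivity),
            ENNReal.ofReal_one, one_mul]
      _ ≤ 4 * κ := by gcongr
  have hUm : AEMeasurable (fun x => ‖U x‖ₑ ^ 2) μ𝕋 := hUL.1.enorm.pow_const 2
  have hAm : AEMeasurable (fun x => ∑' k, ‖A k x‖ₑ ^ 2) μ𝕋 :=
    AEMeasurable.tsum fun k => (hAL k).1.enorm.pow_const 2
  have hbound₀ : eLpLqNorm 1 1 h₀ ≤ 132 * κ := by
    rw [eLpLqNorm_one_one]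
    calc ∫⁻ x, ∑' k, ‖h₀ k x‖ₑ ∂μ𝕋 ≤ _ := lintegral_mono_ae hpt₀
      _ = 4 * eLpLqNorm 1 1 g₀ + 16 * (∫⁻ x, ‖U x‖ₑ ^ 2 ∂μ𝕋 +
            ENNReal.ofReal (1 / t ^ 2) * ∫⁻ x, ∑' k, ‖A k x‖ₑ ^ 2 ∂μ𝕋) := by
          have hm : AEMeasurable (fun x => ‖U x‖ₑ ^ 2 +
              ENNReal.ofReal (1 / t ^ 2) * ∑' k, ‖A k x‖ₑ ^ 2) μ𝕋 := hUm.add (hAm.const_mul _)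
          rw [lintegral_add_left' (hS₀m.const_mul 4), lintegral_const_mul'' _ hS₀m,
            lintegral_const_mul'' _ hm, lintegral_add_left' hUm, lintegral_const_mul'' _ hAm, hN₀]
      _ ≤ 4 * κ + 16 * (4 * κ + 4 * κ) := by gcongr
      _ = 132 * κ := by ring
  have hbound₁ : ENNReal.ofReal t * eLpLqNorm 1 2 h₁ ≤ 24 * κ := by
    rw [eLpLqNorm_one_two, ← lintegral_const_mul' _ _ ENNReal.ofReal_ne_top]
    calc _ ≤ ∫⁻ x, 6 * ‖U x‖ₑ ^ 2 ∂μ𝕋 := lintegral_mono_ae hpt₁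
      _ = 6 * ∫⁻ x, ‖U x‖ₑ ^ 2 ∂μ𝕋 := lintegral_const_mul'' _ hUm
      _ ≤ 6 * (4 * κ) := by gcongr
      _ = 24 * κ := by ring
  have hh₀L : MemLpLq 1 1 h₀ :=
    ⟨hh₀m, hbound₀.trans_lt (ENNReal.mul_lt_top (by norm_num) hκtop)⟩
  have hh₁L : MemLpLq 1 2 h₁ :=
    ⟨hh₁m, ENNReal.lt_top_of_mul_ne_top_right
      (hbound₁.trans_lt (ENNReal.mul_lt_top (by norm_num) hκtop)).ne
      (ENNReal.ofReal_pos.mpr ht).ne'⟩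
  have hzero₀ (k : ℕ) (n : ℤ) (hn : n < 0) : fourierCoeff (h₀ k) n = 0 :=
    fourierCoeff_halfPlaneCutoff_mul_eq_zero (haL k) huL (ha0 k) hu0 (hAL k) hUL (hAc k) hUc
      (hf k) (hf0 k) hn
  have hzero₁ (k : ℕ) (n : ℤ) (hn : n < 0) : fourierCoeff (h₁ k) n = 0 := by
    have h := congrFun (fourierCoeff.add (hh₀L.integrable_one_one k)
      (hh₁L.integrable_one_two k)) n
    rw [← Pi.add_apply, ← hsum, Pi.add_apply, hf0 k n hn, hzero₀ k n hn, zero_add] at h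
    exact h.symm
  refine ⟨h₀, h₁, ⟨hh₀L, hzero₀⟩, ⟨hh₁L, hzero₁⟩, hsum, ?_⟩
  calc _ ≤ 132 * κ + 24 * κ := add_le_add hbound₀ hbound₁
    _ = 156 * κ := by ring
    _ ≤ 200 * κ := by gcongr; norm_num

/-- **Proposition 2**: there is an absolute constant `C` such that for every `t > 0` and every
sequence `f = (f_k)` admitting a decomposition `f = a + b` with `a ∈ H¹(ℓ₁)`, `b ∈ H¹(ℓ₂)`,
one has `K_t(f; H¹(ℓ₁), H¹(ℓ₂)) ≤ C · K_t(f; L¹(ℓ₁), L¹(ℓ₂))`. -/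
theorem K_functional_H1_couple :
    ∃ C : ℝ≥0, 0 < C ∧
      ∀ (t : ℝ), 0 < t →
        ∀ f : ℕ → 𝕋 → ℂ,
          (∃ a b : ℕ → 𝕋 → ℂ, MemHpLq 1 1 a ∧ MemHpLq 1 2 b ∧ f = a + b) →
          Kfunctional (ENNReal.ofReal t) (MemHpLq 1 1) (MemHpLq 1 2)
              (eLpLqNorm 1 1) (eLpLqNorm 1 2) f ≤
            C * Kfunctional (ENNReal.ofReal t) (MemLpLq 1 1) (MemLpLq 1 2)
              (eLpLqNorm 1 1) (eLpLqNorm 1 2) f := by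
  refine ⟨200, by norm_num, fun t ht f ⟨a, b, ha, hb, hab⟩ => ?_⟩
  have hf (k : ℕ) : Integrable (f k) μ𝕋 := by
    rw [hab]
    exact (ha.1.integrable_one_one k).add (hb.1.integrable_one_two k)
  have hf0 (k : ℕ) (n : ℤ) (hn : n < 0) : fourierCoeff (f k) n = 0 := by
    rw [hab, Pi.add_apply, fourierCoeff.add (ha.1.integrable_one_one k)
      (hb.1.integrable_one_two k), Pi.add_apply, ha.2 k n hn, hb.2 k n hn, add_zero]
  have hC0 : ((200 : ℝ≥0) : ℝ≥0∞) ≠ 0 := by norm_num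
  have hCtop : ((200 : ℝ≥0) : ℝ≥0∞) ≠ ⊤ := ENNReal.coe_ne_top
  conv_rhs => rw [Kfunctional]
  simp only [ENNReal.mul_iInf_of_ne hC0 hCtop]
  refine le_iInf fun g₀ => le_iInf fun g₁ => le_iInf fun hg₀ => le_iInf fun hg₁ =>
    le_iInf fun hfg => ?_
  refine ENNReal.le_of_forall_pos_le_add fun ε hε _ => ?_
  obtain ⟨h₀, h₁, hh₀, hh₁, hfh, hle⟩ :=
    exists_analytic_decomposition ht hf hf0 hg₀ hg₁ hfg (ε := ε / 200) (by positivity)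
  have hK : Kfunctional (ENNReal.ofReal t) (MemHpLq 1 1) (MemHpLq 1 2) (eLpLqNorm 1 1)
      (eLpLqNorm 1 2) f ≤ eLpLqNorm 1 1 h₀ + ENNReal.ofReal t * eLpLqNorm 1 2 h₁ :=
    iInf_le_of_le h₀ (iInf_le_of_le h₁ (iInf_le_of_le hh₀ (iInf_le_of_le hh₁
      (iInf_le_of_le hfh le_rfl))))
  refine hK.trans (hle.trans_eq ?_)
  rw [mul_add, show (200 : ℝ≥0∞) = ENNReal.ofReal 200 by simp, ← ENNReal.ofReal_mul (by norm_num),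
    mul_div_cancel₀ _ (by norm_num : (200 : ℝ) ≠ 0), ENNReal.ofReal_coe_nnreal]
  congr 2
  simp
end
end
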